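/- Let W=(w_{ij}) be a nonnegative real m×n matrix, let R_1,…,R_p be positive integer m-vectors and C_1,…,C_p be positive integer n-vectors with |R_1|=…=|R_p|=|C_1|=…=|C_p|=N, and let α_1,…,α_p ≥ 0 satisfy α_1+…+α_p=1. Suppose R = Σ_{k=1}^p α_k R_k = (r_1,…,r_m) and C = Σ_{k=1}^p α_k C_k = (c_1,…,c_n) are again positive integer vectors. Then (N^N/N!) · min{ ∏_{i=1}^m r_i!/r_i^{r_i}, ∏_{j=1}^n c_j!/c_j^{c_j} } · T(R,C;W) ≥ ∏_{k=1}^p T(R_k,C_k;W)^{α_k}. -/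

import Mathlib

open scoped BigOperators

/-- The total weight `T(R,C;W)` of contingency tables with row sums `R`,
column sums `C`, and weight `∏ W i j ^ D i j` (with the convention `0 ^ 0 = 1`). -/
noncomputable def tableWeight {m n : ℕ} (R : Fin m → ℕ) (C : Fin n → ℕ)
    (W : Fin m → Fin n → ℝ) : ℝ :=
  ∑' D : {D : Fin m → Fin n → ℕ //
      (∀ i, ∑ j, D i j = R i) ∧ (∀ j, ∑ i, D i j = C j)},
    ∏ i, ∏ j, W i j ^ D.1 i j

section Helpers

open Finset

/-- Hermite's identity for natural numbers. -/
lemma sum_range_add_div_eq (M : ℕ) (hM : 0 < M) (T : ℕ) :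
    ∑ l ∈ range M, (T + l) / M = T := by
  induction T with
  | zero =>
    apply sum_eq_zero
    intro l hl
    simpa using Nat.div_eq_of_lt (mem_range.1 hl)
  | succ T ih =>
    have h1 := sum_range_succ (fun l => (T + l) / M) M
    have h2 := sum_range_succ' (fun l => (T + l) / M) M
    rw [h1, ih, Nat.add_div_right _ hM] at h2
    have h3 : ∑ l ∈ range M, (T + 1 + l) / M = ∑ l ∈ range M, (T + (l + 1)) / M :=
      sum_congr rfl fun l _ => by congr 1; ring
    rw [h3]
    simp only [add_zero] at h2
    omega

lemma card_filter_add_div_eq_le {M : ℕ} (hM : 0 < M) (x y : Fin M → ℕ) (hxy : ∀ k, x k ≤ y k) :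
    #{l ∈ range M | (∑ k, y k + l) / M = (∑ k, x k + l) / M} ≤ #{k | y k = x k} := by
  set T := ∑ k, y k with hT
  set T' := ∑ k, x k with hT'
  have hle : T' ≤ T := sum_le_sum fun k _ => hxy k
  have hk : #{k | y k ≠ x k} ≤ T - T' := by
    have : T = T' + ∑ k, (y k - x k) := by
      rw [hT, hT', ← sum_add_distrib]
      exact sum_congr rfl fun k _ => by have := hxy k; omega
    rw [this, Nat.add_sub_cancel_left, card_filter]
    refine sum_le_sum fun k _ => ?_
    have := hxy k
    split_ifs <;> omega
  have hkk : #{k | y k = x k} + #{k | y k ≠ x k} = M := by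
    have := card_filter_add_card_filter_not (s := (univ : Finset (Fin M)))
      (fun k => y k = x k)
    simpa using this
  have hll := card_filter_add_card_filter_not (s := range M)
      (fun l => (T + l) / M = (T' + l) / M)
  rw [card_range] at hll
  by_cases hbig : M ≤ T - T'
  · have : #{l ∈ range M | (T + l) / M = (T' + l) / M} = 0 := by
      rw [card_eq_zero, filter_eq_empty_iff]
      intro l _ h
      have h1 : (T' + l) / M + 1 ≤ (T + l) / M := by
        rw [← Nat.add_div_right _ hM]
        exact Nat.div_le_div_right (by omega)
      omega
    omega
  · have : T - T' ≤ #{l ∈ range M | ¬ (T + l) / M = (T' + l) / M} := by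
      have h1 := sum_range_add_div_eq M hM T
      have h2 := sum_range_add_div_eq M hM T'
      have h3 : ∑ l ∈ range M, (T + l) / M ≤ ∑ l ∈ range M, ((T' + l) / M +
          if ¬ (T + l) / M = (T' + l) / M then 1 else 0) := by
        refine sum_le_sum fun l _ => ?_
        have h4 : (T + l) / M ≤ (T' + l) / M + 1 := by
          rw [← Nat.add_div_right _ hM]
          exact Nat.div_le_div_right (by omega)
        split_ifs <;> omega
      rw [sum_add_distrib, ← card_filter] at h3
      omega
    omega

/-- The increment `(i + 1) log (i + 1) - i log i`. -/
noncomputable def entropyStep (i : ℕ) : ℝ :=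
  ((i + 1 : ℕ) : ℝ) * Real.log ((i + 1 : ℕ) : ℝ) - (i : ℝ) * Real.log (i : ℝ)

lemma entropyStep_zero : entropyStep 0 = 0 := by simp [entropyStep]

lemma entropyStep_mono (i : ℕ) : entropyStep i ≤ entropyStep (i + 1) := by
  have hconv := Real.convexOn_mul_log
  have h := hconv.2 (Set.mem_Ici.2 (Nat.cast_nonneg' i))
    (Set.mem_Ici.2 (Nat.cast_nonneg' (i + 1 + 1)))
    (show (0 : ℝ) ≤ 1 / 2 by norm_num) (show (0 : ℝ) ≤ 1 / 2 by norm_num) (by norm_num)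
  have e : (1 / 2 : ℝ) • (i : ℝ) + (1 / 2 : ℝ) • ((i + 1 + 1 : ℕ) : ℝ) = ((i + 1 : ℕ) : ℝ) := by
    push_cast; simp only [smul_eq_mul]; ring
  simp only [e] at h
  simp only [smul_eq_mul] at h
  unfold entropyStep
  linarith

lemma sum_log_card_fiber (q : ℕ → ℕ) (K : ℕ) :
    ∑ a ∈ range K, Real.log (#{a' ∈ range K | q a' = q a} : ℝ) =
      ∑ a ∈ range K, entropyStep #{a' ∈ range a | q a' = q a} := by
  obtain ⟨B, hB⟩ : ∃ B, ∀ a ∈ range K, q a ∈ range B :=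
    ⟨(range K).sup q + 1, fun a ha => mem_range.2 (Nat.lt_succ_of_le (le_sup (f := q) ha))⟩
  have key : ∀ J ≤ K, ∑ v ∈ range B, (#{a' ∈ range J | q a' = v} : ℝ) *
      Real.log (#{a' ∈ range J | q a' = v} : ℝ) =
      ∑ a ∈ range J, entropyStep #{a' ∈ range a | q a' = q a} := by
    intro J
    induction J with
    | zero => simp
    | succ J ih =>
      intro hJ
      rw [sum_range_succ, ← ih (by omega)]
      have hq : q J ∈ range B := hB J (mem_range.2 (by omega))
      rw [← add_sum_erase _ _ hq, ← add_sum_erase (range B) (fun v =>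
        (#{a' ∈ range J | q a' = v} : ℝ) * Real.log (#{a' ∈ range J | q a' = v} : ℝ)) hq]
      have h1 : #{a' ∈ range (J + 1) | q a' = q J} = #{a' ∈ range J | q a' = q J} + 1 := by
        rw [range_add_one, filter_insert, if_pos rfl, card_insert_of_notMem (by simp)]
      have h2 : ∀ v ∈ (range B).erase (q J),
          #{a' ∈ range (J + 1) | q a' = v} = #{a' ∈ range J | q a' = v} := by
        intro v hv
        rw [range_add_one, filter_insert, if_neg (fun h => (mem_erase.1 hv).1 h.symm)]
      rw [h1, sum_congr rfl (g := fun v =>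
        (#{a' ∈ range J | q a' = v} : ℝ) * Real.log (#{a' ∈ range J | q a' = v} : ℝ))
        (fun v hv => by rw [h2 v hv])]
      unfold entropyStep
      ring
  rw [← key K le_rfl, ← sum_fiberwise_of_maps_to hB]
  refine sum_congr rfl fun v _ => ?_
  rw [sum_congr rfl (g := fun _ => Real.log (#{a' ∈ range K | q a' = v} : ℝ))]
  · rw [sum_const, nsmul_eq_mul]
  · intro a ha
    rw [(mem_filter.1 ha).2]

lemma lt_card_filter_iff {q : ℕ → ℕ} (hq : Monotone q) {a s : ℕ} (hs : s < a) :
    s < #{a' ∈ range a | q a' = q a} ↔ q a = q (a - 1 - s) := by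
  constructor
  · intro h
    by_contra hne
    have hlt : q (a - 1 - s) < q a := lt_of_le_of_ne (hq (by omega)) (Ne.symm hne)
    have hsub : ({a' ∈ range a | q a' = q a} : Finset ℕ) ⊆ Ico (a - s) a := by
      intro a' ha'
      rw [mem_filter, mem_range] at ha'
      rw [mem_Ico]
      refine ⟨?_, ha'.1⟩
      by_contra hc
      have := hq (show a' ≤ a - 1 - s by omega)
      omega
    have := card_le_card hsub
    rw [Nat.card_Ico] at this
    omega
  · intro h
    have hsub : Ico (a - 1 - s) a ⊆ ({a' ∈ range a | q a' = q a} : Finset ℕ) := by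
      intro a' ha'
      rw [mem_Ico] at ha'
      rw [mem_filter, mem_range]
      have h1 := hq ha'.1
      have h2 := hq ha'.2.le
      exact ⟨ha'.2, by omega⟩
    have := card_le_card hsub
    rw [Nat.card_Ico] at this
    omega

lemma entropyStep_card_eq {q : ℕ → ℕ} (hq : Monotone q) (a : ℕ) :
    entropyStep #{a' ∈ range a | q a' = q a} =
      ∑ s ∈ range a, (entropyStep (s + 1) - entropyStep s) *
        (if q a = q (a - 1 - s) then 1 else 0) := by
  set c := #{a' ∈ range a | q a' = q a} with hc
  have hca : c ≤ a := by
    simpa using card_filter_le (range a) (fun a' => q a' = q a)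
  have h1 : entropyStep c = ∑ s ∈ range c, (entropyStep (s + 1) - entropyStep s) := by
    rw [sum_range_sub, entropyStep_zero, sub_zero]
  rw [h1]
  have h2 : range c = {s ∈ range a | s < c} := by
    ext s; simp only [mem_range, mem_filter]; omega
  rw [h2, sum_filter]
  refine sum_congr rfl fun s hs => ?_
  have := lt_card_filter_iff hq (mem_range.1 hs)
  rw [← hc] at this
  by_cases h : s < c
  · rw [if_pos h, if_pos (this.1 h), mul_one]
  · rw [if_neg h, if_neg (fun h' => h (this.2 h')), mul_zero]

lemma sum_log_card_fiber_le {M : ℕ} (hM : 0 < M) (q : Fin M → ℕ → ℕ) (hq : ∀ k, Monotone (q k))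
    (K : ℕ) :
    ∑ l ∈ range M, ∑ a ∈ range K,
        Real.log (#{a' ∈ range K | (∑ k, q k a' + l) / M = (∑ k, q k a + l) / M} : ℝ) ≤
      ∑ k, ∑ a ∈ range K, Real.log (#{a' ∈ range K | q k a' = q k a} : ℝ) := by
  have hS : ∀ l, Monotone fun a => (∑ k, q k a + l) / M := fun l a b hab =>
    Nat.div_le_div_right (Nat.add_le_add_right (sum_le_sum fun k _ => hq k hab) l)
  have e1 : ∀ l, ∑ a ∈ range K,
      Real.log (#{a' ∈ range K | (∑ k, q k a' + l) / M = (∑ k, q k a + l) / M} : ℝ) = _ :=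
    fun l => sum_log_card_fiber (fun a => (∑ k, q k a + l) / M) K
  rw [sum_congr rfl (fun l _ => e1 l),
    sum_congr rfl (s₁ := (univ : Finset (Fin M))) (fun k _ => sum_log_card_fiber (q k) K),
    sum_comm, sum_comm (s := (univ : Finset (Fin M)))]
  refine sum_le_sum fun a _ => ?_
  rw [sum_congr rfl (fun l _ => entropyStep_card_eq (hS l) a),
    sum_congr rfl (s₁ := (univ : Finset (Fin M))) (fun k _ => entropyStep_card_eq (hq k) a),
    sum_comm, sum_comm (s := (univ : Finset (Fin M)))]
  refine sum_le_sum fun s _ => ?_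
  rw [← mul_sum, ← mul_sum]
  refine mul_le_mul_of_nonneg_left ?_ (sub_nonneg.2 (entropyStep_mono s))
  rw [sum_boole, sum_boole]
  exact_mod_cast card_filter_add_div_eq_le hM (fun k => q k (a - 1 - s)) (fun k => q k a)
    (fun k => hq k (by omega))

lemma exists_monotone_card_fiber (B : ℕ) (N : ℕ → ℕ) :
    ∃ q : ℕ → ℕ, Monotone q ∧ (∀ a, q a ≤ B) ∧ (∀ a < ∑ v ∈ range B, N v, q a < B) ∧
      ∀ v < B, #{a ∈ range (∑ v ∈ range B, N v) | q a = v} = N v := by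
  induction B with
  | zero => exact ⟨fun _ => 0, monotone_const, by simp, by simp, by simp⟩
  | succ B ih =>
    obtain ⟨q, hq, hqB, hlt, hf⟩ := ih
    set K := ∑ v ∈ range B, N v with hK
    refine ⟨fun a => if a < K then q a else B, ?_, ?_, ?_, ?_⟩
    · intro a b hab
      dsimp only
      have := hq hab
      have := hqB a
      split_ifs <;> omega
    · intro a
      dsimp only
      have := hqB a
      split_ifs <;> omega
    · intro a _
      dsimp only
      have := hqB a
      split_ifs <;> omega
    · intro v hv
      rw [sum_range_succ, ← hK]
      rcases Nat.lt_succ_iff_lt_or_eq.1 hv with h | h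
      · rw [← hf v h]
        congr 1
        ext a
        simp only [mem_filter, mem_range]
        split_ifs <;> constructor <;> intro ⟨_, _⟩ <;> constructor <;> omega
      · subst h
        have : ({a ∈ range (K + N v) | (if a < K then q a else v) = v} : Finset ℕ) =
            Ico K (K + N v) := by
          ext a
          simp only [mem_filter, mem_range, mem_Ico]
          have := hlt a
          split_ifs <;> constructor <;> intro ⟨_, _⟩ <;> constructor <;> omega
        rw [this, Nat.card_Ico]; omega

/-- The inequality of arithmetic and geometric means in polynomial form. -/
lemma prod_le_sum_div_card_pow {ι : Type*} (s : Finset ι) (z : ι → ℝ) (hz : ∀ i ∈ s, 0 ≤ z i) :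
    ∏ i ∈ s, z i ≤ ((∑ i ∈ s, z i) / #s) ^ #s := by
  rcases s.eq_empty_or_nonempty with rfl | hs
  · simp
  have hc : (0 : ℝ) < #s := by exact_mod_cast card_pos.2 hs
  have h := Real.geom_mean_le_arith_mean s (fun _ => 1) z (fun _ _ => zero_le_one)
    (by simpa using hc) hz
  simp only [Real.rpow_one, one_mul, sum_const, nsmul_eq_mul, mul_one] at h
  have hp : 0 ≤ ∏ i ∈ s, z i := prod_nonneg hz
  calc ∏ i ∈ s, z i = ((∏ i ∈ s, z i) ^ (#s : ℝ)⁻¹) ^ #s := by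
        rw [Real.rpow_inv_natCast_pow hp (card_pos.2 hs).ne']
    _ ≤ _ := pow_le_pow_left₀ (Real.rpow_nonneg hp _) h _

lemma prod_div_card_fiber_le (B K : ℕ) (S : ℕ → ℕ) (hS : ∀ a < K, S a < B) (H : ℕ → ℝ)
    (hH : ∀ v, 0 ≤ H v) :
    ∏ a ∈ range K, H (S a) / (#{a' ∈ range K | S a' = S a} : ℝ) ≤
      ((∑ v ∈ range B, H v) / K) ^ K := by
  rcases Nat.eq_zero_or_pos K with rfl | hK
  · simp
  have h := prod_le_sum_div_card_pow (range K)
    (fun a => H (S a) / (#{a' ∈ range K | S a' = S a} : ℝ))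
    (fun a _ => div_nonneg (hH _) (Nat.cast_nonneg _))
  rw [card_range] at h
  refine h.trans (pow_le_pow_left₀ (div_nonneg (sum_nonneg fun a _ =>
    div_nonneg (hH _) (Nat.cast_nonneg _)) (Nat.cast_nonneg _)) ?_ _)
  refine div_le_div_of_nonneg_right ?_ (Nat.cast_nonneg _)
  rw [← sum_fiberwise_of_maps_to (t := range B)
    (fun a ha => mem_range.2 (hS a (mem_range.1 ha)))]
  refine sum_le_sum fun v _ => ?_
  rw [sum_congr rfl (g := fun _ => H v / (#{a' ∈ range K | S a' = v} : ℝ))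
    (fun a ha => by rw [(mem_filter.1 ha).2]), sum_const, nsmul_eq_mul]
  by_cases h0 : (#{a' ∈ range K | S a' = v} : ℝ) = 0
  · rw [h0, zero_mul]; exact hH v
  · rw [mul_div_cancel₀ _ h0]

lemma discrete_prekopa_leindler_nat {M : ℕ} (hM : 0 < M) (B : ℕ) (f : Fin M → ℕ → ℕ)
    (H : ℕ → ℕ → ℝ) (hH : ∀ l v, 0 ≤ H l v) (c : ℝ) (hc : 0 ≤ c)
    (h : ∀ s : Fin M → ℕ, (∀ k, s k < B) →
      ∏ k, (f k (s k) : ℝ) ≤ c * ∏ l ∈ range M, H l ((∑ k, s k + l) / M)) :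
    ∏ k, ∑ v ∈ range B, (f k v : ℝ) ≤ c * ∏ l ∈ range M, ∑ v ∈ range B, H l v := by
  have hR : 0 ≤ c * ∏ l ∈ range M, ∑ v ∈ range B, H l v :=
    mul_nonneg hc (prod_nonneg fun l _ => sum_nonneg fun v _ => hH l v)
  set Z : Fin M → ℕ := fun k => ∑ v ∈ range B, f k v with hZ
  have hZc : ∀ k, ∑ v ∈ range B, (f k v : ℝ) = Z k := fun k => by simp [hZ]
  simp only [hZc]
  by_cases hz : ∃ k, Z k = 0
  · obtain ⟨k, hk⟩ := hz
    rw [prod_eq_zero (mem_univ k) (by simp [hk])]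
    exact hR
  push Not at hz
  set K : ℕ := ∏ k, Z k with hK
  have hKpos : 0 < K := prod_pos fun k _ => Nat.pos_of_ne_zero (hz k)
  have hKr : (0 : ℝ) < K := by exact_mod_cast hKpos
  have hZr : ∀ k, (0 : ℝ) < Z k := fun k => by exact_mod_cast Nat.pos_of_ne_zero (hz k)
  have hdiv : ∀ k, Z k ∣ K := fun k => dvd_prod_of_mem Z (mem_univ k)
  choose q hq hqB hqlt hqf using fun k => exists_monotone_card_fiber B fun v => f k v * (K / Z k)
  have hsum : ∀ k, ∑ v ∈ range B, f k v * (K / Z k) = K := fun k => by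
    rw [← sum_mul]; exact Nat.mul_div_cancel' (hdiv k)
  simp only [hsum] at hqlt hqf
  have hfk : ∀ k, ∀ a < K, (f k (q k a) : ℝ) = #{a' ∈ range K | q k a' = q k a} * (Z k / K) := by
    intro k a ha
    rw [hqf k _ (hqlt k a ha)]
    push_cast [Nat.cast_div (hdiv k) (hZr k).ne']
    have := (hZr k).ne'
    field_simp
  set S : ℕ → ℕ → ℕ := fun l a => (∑ k, q k a + l) / M with hS
  have hSB : ∀ l < M, ∀ a < K, S l a < B := by
    intro l hl a ha
    rw [hS]
    dsimp only
    rw [Nat.div_lt_iff_lt_mul hM]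
    have hB : 0 < B := Nat.pos_of_ne_zero fun h0 => by
      have := hqlt ⟨0, hM⟩ a ha; omega
    have : ∑ k : Fin M, q k a ≤ ∑ k : Fin M, (B - 1) :=
      sum_le_sum fun k _ => by have := hqlt k a ha; omega
    rw [sum_const, card_univ, Fintype.card_fin, smul_eq_mul] at this
    obtain ⟨b, rfl⟩ : ∃ b, B = b + 1 := ⟨B - 1, by omega⟩
    simp only [Nat.add_sub_cancel] at this
    nlinarith
  set P : ℝ := ∏ k, ∏ a ∈ range K, (#{a' ∈ range K | q k a' = q k a} : ℝ) with hP
  set Q : ℝ := ∏ l ∈ range M, ∏ a ∈ range K, (#{a' ∈ range K | S l a' = S l a} : ℝ) with hQ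
  have hcp : ∀ (g : ℕ → ℕ), ∀ a ∈ range K, (0 : ℝ) < #{a' ∈ range K | g a' = g a} := by
    intro g a ha
    have hmem : a ∈ ({a' ∈ range K | g a' = g a} : Finset ℕ) := mem_filter.2 ⟨ha, rfl⟩
    exact_mod_cast card_pos.2 ⟨a, hmem⟩
  have hPpos : 0 < P := prod_pos fun k _ => prod_pos fun a ha => hcp (q k) a ha
  have hQpos : 0 < Q := prod_pos fun l _ => prod_pos fun a ha => hcp (S l) a ha
  have hQP : Q ≤ P := by
    rw [← Real.log_le_log_iff hQpos hPpos, hP, hQ,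
      Real.log_prod (fun k _ => (prod_pos fun a ha => hcp (q k) a ha).ne'),
      Real.log_prod (fun l _ => (prod_pos fun a ha => hcp (S l) a ha).ne')]
    have e1 : ∀ g : ℕ → ℕ, Real.log (∏ a ∈ range K, (#{a' ∈ range K | g a' = g a} : ℝ)) =
        ∑ a ∈ range K, Real.log (#{a' ∈ range K | g a' = g a} : ℝ) :=
      fun g => Real.log_prod (fun a ha => (hcp g a ha).ne')
    simp only [e1]
    exact sum_log_card_fiber_le hM q hq K
  have hmain : ∏ a ∈ range K, ∏ k, (f k (q k a) : ℝ) ≤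
      ∏ a ∈ range K, (c * ∏ l ∈ range M, H l (S l a)) :=
    prod_le_prod (fun a _ => prod_nonneg fun k _ => Nat.cast_nonneg _)
      (fun a ha => h (fun k => q k a) fun k => hqlt k a (mem_range.1 ha))
  have hlhs : ∏ a ∈ range K, ∏ k, (f k (q k a) : ℝ) = P * (∏ k, (Z k : ℝ) / K) ^ K := by
    rw [prod_comm, hP, ← prod_pow, ← prod_mul_distrib]
    refine prod_congr rfl fun k _ => ?_
    rw [prod_congr rfl (fun a ha => hfk k a (mem_range.1 ha)), prod_mul_distrib, prod_const,
      card_range]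
  have hrhs : ∏ a ∈ range K, (c * ∏ l ∈ range M, H l (S l a)) ≤
      c ^ K * ((∏ l ∈ range M, (∑ v ∈ range B, H l v) / K) ^ K * Q) := by
    rw [prod_mul_distrib, prod_const, card_range]
    refine mul_le_mul_of_nonneg_left ?_ (pow_nonneg hc _)
    rw [prod_comm, hQ, ← prod_pow, ← prod_mul_distrib]
    refine prod_le_prod (fun l _ => prod_nonneg fun a _ => hH _ _) fun l hl => ?_
    have h1 := prod_div_card_fiber_le B K (S l) (hSB l (mem_range.1 hl)) (H l) (hH l)
    rwa [prod_div_distrib, div_le_iff₀ (prod_pos fun a ha => hcp (S l) a ha)] at h1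
  have hX : 0 ≤ ∏ l ∈ range M, (∑ v ∈ range B, H l v) / K :=
    prod_nonneg fun l _ => div_nonneg (sum_nonneg fun v _ => hH l v) hKr.le
  have hfin : P * (∏ k, (Z k : ℝ) / K) ^ K ≤
      P * (c * ∏ l ∈ range M, (∑ v ∈ range B, H l v) / K) ^ K := by
    rw [← hlhs]
    refine (hmain.trans hrhs).trans ?_
    rw [mul_pow]
    have : 0 ≤ c ^ K * (∏ l ∈ range M, (∑ v ∈ range B, H l v) / K) ^ K := by positivity
    nlinarith
  have h2 := le_of_mul_le_mul_left hfin hPpos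
  have h3 := (pow_le_pow_iff_left₀ (prod_nonneg fun k _ => by positivity)
    (mul_nonneg hc hX) hKpos.ne').1 h2
  rw [prod_div_distrib, prod_div_distrib, prod_const, prod_const, card_range, card_univ,
    Fintype.card_fin, ← mul_div_assoc, div_le_div_iff_of_pos_right (by positivity)] at h3
  exact h3

lemma discrete_prekopa_leindler {M : ℕ} (hM : 0 < M) (B : ℕ) (f : Fin M → ℕ → ℝ)
    (hf : ∀ k v, 0 ≤ f k v)
    (H : ℕ → ℕ → ℝ) (hH : ∀ l v, 0 ≤ H l v) (c : ℝ) (hc : 0 ≤ c)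
    (h : ∀ s : Fin M → ℕ, (∀ k, s k < B) →
      ∏ k, f k (s k) ≤ c * ∏ l ∈ range M, H l ((∑ k, s k + l) / M)) :
    ∏ k, ∑ v ∈ range B, f k v ≤ c * ∏ l ∈ range M, ∑ v ∈ range B, H l v := by
  have hlim : Filter.Tendsto (fun x : ℝ => ∏ k, ∑ v ∈ range B, (⌊f k v * x⌋₊ : ℝ) / x)
      Filter.atTop (nhds (∏ k, ∑ v ∈ range B, f k v)) :=
    tendsto_finsetProd _ fun k _ => tendsto_finsetSum _ fun v _ =>
      tendsto_nat_floor_mul_div_atTop (hf k v)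
  refine le_of_tendsto hlim ?_
  filter_upwards [Filter.eventually_gt_atTop 0] with x hx
  have h1 := discrete_prekopa_leindler_nat hM B (fun k v => ⌊f k v * x⌋₊) H hH (c * x ^ M)
    (by positivity) (fun s hs => by
      calc ∏ k, (⌊f k (s k) * x⌋₊ : ℝ) ≤ ∏ k, f k (s k) * x :=
            prod_le_prod (fun k _ => Nat.cast_nonneg _)
              (fun k _ => Nat.floor_le (mul_nonneg (hf _ _) hx.le))
        _ = (∏ k, f k (s k)) * x ^ M := by
            rw [prod_mul_distrib, prod_const, card_univ, Fintype.card_fin]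
        _ ≤ _ := by
            have := mul_le_mul_of_nonneg_right (h s hs) (pow_nonneg hx.le M)
            linarith)
  simp only [← sum_div]
  rw [prod_div_distrib, prod_const, card_univ, Fintype.card_fin, div_le_iff₀ (by positivity)]
  linarith

section Gurvits

open MvPolynomial

/-- A real polynomial is stable if it has no zero with all coordinates in the open upper
half plane. -/
def IsStable {σ : Type*} (F : MvPolynomial σ ℝ) : Prop :=
  ∀ z : σ → ℂ, (∀ j, 0 < (z j).im) → aeval z F ≠ 0

/-- The derivative of a polynomial in the direction `a`. -/
noncomputable def dirDeriv {σ : Type*} (a : σ → ℝ) :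
    Derivation ℝ (MvPolynomial σ ℝ) (MvPolynomial σ ℝ) :=
  mkDerivation ℝ fun j => C (a j)

/-- The restriction of `F` to the line through `z` with direction `a`. -/
noncomputable def lineRestrict {σ : Type*} (z : σ → ℂ) (a : σ → ℝ) (F : MvPolynomial σ ℝ) :
    Polynomial ℂ :=
  aeval (fun j => Polynomial.C (z j) + Polynomial.C (a j : ℂ) * Polynomial.X) F

variable {σ : Type*}

lemma eval_lineRestrict (z : σ → ℂ) (a : σ → ℝ) (F : MvPolynomial σ ℝ) (s : ℂ) :
    (lineRestrict z a F).eval s = aeval (fun j => z j + a j * s) F := by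
  unfold lineRestrict
  have h := MvPolynomial.map_aeval (fun j => Polynomial.C (z j) + Polynomial.C (a j : ℂ) *
    Polynomial.X) (Polynomial.evalRingHom s) F
  rw [Polynomial.coe_evalRingHom] at h
  rw [h, aeval_def, coe_eval₂Hom]
  congr 1
  · ext x
    simp
  · ext j
    simp

lemma derivative_lineRestrict (z : σ → ℂ) (a : σ → ℝ) (F : MvPolynomial σ ℝ) :
    (lineRestrict z a F).derivative = lineRestrict z a (dirDeriv a F) := by
  unfold lineRestrict
  induction F using MvPolynomial.induction_on with
  | C r =>
    have : dirDeriv a (C r) = 0 := Derivation.map_algebraMap _ _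
    rw [this, map_zero, aeval_C, IsScalarTower.algebraMap_apply ℝ ℂ (Polynomial ℂ),
      Polynomial.algebraMap_apply, Polynomial.derivative_C]
  | add p q hp hq => simp only [map_add, hp, hq]
  | mul_X p i hp =>
    have : dirDeriv a (X i) = C (a i) := mkDerivation_X _ _ _
    rw [Derivation.leibniz, map_mul, Polynomial.derivative_mul, hp, this]
    simp only [smul_eq_mul, map_add, map_mul, aeval_X, aeval_C,
      Polynomial.derivative_C, Polynomial.derivative_mul, Polynomial.derivative_X]
    rw [IsScalarTower.algebraMap_apply ℝ ℂ (Polynomial ℂ)]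
    simp only [Complex.coe_algebraMap, Polynomial.algebraMap_apply, Algebra.algebraMap_self,
      RingHom.id_apply]
    ring

lemma sum_support_eq_of_isHomogeneous {F : MvPolynomial σ ℝ} {d : ℕ} (hF : F.IsHomogeneous d)
    {m : σ →₀ ℕ} (hm : m ∈ F.support) : ∑ i ∈ m.support, m i = d := by
  have := hF (mem_support_iff.1 hm)
  rw [Finsupp.weight_apply, Finsupp.sum] at this
  simpa using this

lemma natDegree_lineRestrict_le (z : σ → ℂ) (a : σ → ℝ) {F : MvPolynomial σ ℝ} {d : ℕ}
    (hF : F.IsHomogeneous d) : (lineRestrict z a F).natDegree ≤ d := by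
  unfold lineRestrict
  rw [aeval_def, eval₂_eq]
  refine Polynomial.natDegree_sum_le_of_forall_le _ _ fun m hm => ?_
  rw [IsScalarTower.algebraMap_apply ℝ ℂ (Polynomial ℂ)]
  refine (Polynomial.natDegree_C_mul_le _ _).trans ((Polynomial.natDegree_prod_le _ _).trans ?_)
  have hd : ∑ i ∈ m.support, m i = d := by
    exact sum_support_eq_of_isHomogeneous hF hm
  rw [← hd]
  refine sum_le_sum fun i _ => ?_
  refine Polynomial.natDegree_pow_le.trans ?_
  have : (Polynomial.C (z i) + Polynomial.C (a i : ℂ) * Polynomial.X).natDegree ≤ 1 := by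
    compute_degree
  nlinarith

lemma aeval_smul_of_isHomogeneous {S : Type*} [CommRing S] [Algebra ℝ S] {F : MvPolynomial σ ℝ}
    {d : ℕ} (hF : F.IsHomogeneous d) (c : S) (z : σ → S) :
    aeval (fun j => c * z j) F = c ^ d * aeval z F := by
  rw [aeval_def, aeval_def, eval₂_eq, eval₂_eq, mul_sum]
  refine sum_congr rfl fun m hm => ?_
  have hd : ∑ i ∈ m.support, m i = d := sum_support_eq_of_isHomogeneous hF hm
  simp only [mul_pow, prod_mul_distrib, prod_pow_eq_pow_sum, hd]
  ring

lemma aeval_ofReal (y : σ → ℝ) (F : MvPolynomial σ ℝ) :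
    aeval (fun j => (y j : ℂ)) F = (eval y F : ℂ) := by
  have := aeval_algebraMap_apply ℂ y F
  simpa [Function.comp_def, coe_aeval_eq_eval] using this

lemma eval_pos_of_coeff_nonneg {F : MvPolynomial σ ℝ} (hF : ∀ m, 0 ≤ coeff m F) (h0 : F ≠ 0)
    {y : σ → ℝ} (hy : ∀ j, 0 < y j) : 0 < eval y F := by
  rw [eval_eq]
  refine sum_pos (fun m hm => mul_pos (lt_of_le_of_ne (hF m) (mem_support_iff.1 hm).symm)
    (prod_pos fun i _ => pow_pos (hy i) _)) ?_
  exact support_nonempty.2 h0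

lemma stable_dirDeriv {F : MvPolynomial σ ℝ} {d : ℕ} (hF : F.IsHomogeneous (d + 1))
    (hs : IsStable F) {a : σ → ℝ} (ha : ∀ j, 0 < a j) (hFa : eval a F ≠ 0) :
    IsStable (dirDeriv a F) := by
  intro z hz hzero
  set P := lineRestrict z a F with hP
  have hP0 : P.eval 0 = aeval z F := by
    rw [hP, eval_lineRestrict]; simp
  have hPne : P.eval 0 ≠ 0 := hP0 ▸ hs z hz
  have hder : P.derivative.eval 0 = 0 := by
    rw [hP, derivative_lineRestrict, eval_lineRestrict]
    simpa using hzero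
  have hroots : ∀ ρ ∈ P.roots, ρ.im < 0 := by
    intro ρ hρ
    by_contra hc
    push Not at hc
    have h1 := Polynomial.isRoot_of_mem_roots hρ
    rw [Polynomial.IsRoot, hP, eval_lineRestrict] at h1
    refine hs _ (fun j => ?_) h1
    have := mul_nonneg (ha j).le hc
    have := hz j
    simp
    linarith
  have hsplit := IsAlgClosed.splits P
  have hsum := hsplit.eval_derivative_eq_eval_mul_sum hPne
  rw [hder, eq_comm, mul_eq_zero, or_iff_right hPne] at hsum
  have him := congrArg Complex.im hsum
  have him2 : (P.roots.map fun r => (1 / (0 - r)).im).sum = 0 := by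
    have := map_multiset_sum Complex.imAddGroupHom (P.roots.map fun z ↦ 1 / (0 - z))
    rw [hsum, Multiset.map_map] at this
    simpa using this.symm
  have hneg : ∀ r ∈ P.roots, (1 / (0 - r)).im < 0 := by
    intro r hr
    have h1 := hroots r hr
    have h2 : 0 < Complex.normSq (0 - r) := by
      apply Complex.normSq_pos.2
      intro h
      rw [zero_sub, neg_eq_zero] at h
      rw [h] at h1
      simp at h1
    rw [one_div, Complex.inv_im]
    apply div_neg_of_neg_of_pos _ h2
    simp [h1]
  have hempty : P.roots = 0 := by
    by_contra hne
    have := Multiset.sum_lt_sum_of_nonempty (f := fun r : ℂ => (1 / (0 - r)).im)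
      (g := fun _ => (0 : ℝ)) hne hneg
    rw [him2] at this
    simp at this
  obtain ⟨c, hc⟩ : ∃ c, P = Polynomial.C c := by
    refine ⟨P.leadingCoeff, ?_⟩
    have := hsplit.eq_prod_roots
    rw [hempty] at this
    simpa using this
  have hline : ∀ t : ℂ, t ≠ 0 → aeval (fun j => (a j : ℂ) + t * z j) F = c * t ^ (d + 1) := by
    intro t ht
    have h1 := aeval_smul_of_isHomogeneous hF t (fun j => z j + a j * t⁻¹)
    have h2 : (fun j => (a j : ℂ) + t * z j) = fun j => t * (z j + a j * t⁻¹) := by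
      ext j; field_simp; ring
    rw [h2, h1, ← eval_lineRestrict, ← hP, hc, Polynomial.eval_C]
    ring
  set Q : Polynomial ℂ := aeval (fun j => Polynomial.C (a j : ℂ) + Polynomial.X *
    Polynomial.C (z j)) F with hQ
  have hQe : ∀ t, Q.eval t = aeval (fun j => (a j : ℂ) + t * z j) F := by
    intro t
    have h := MvPolynomial.map_aeval (fun j => Polynomial.C (a j : ℂ) + Polynomial.X *
      Polynomial.C (z j)) (Polynomial.evalRingHom t) F
    rw [Polynomial.coe_evalRingHom] at h
    rw [hQ, h, aeval_def, coe_eval₂Hom]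
    congr 1
    · ext x
      simp
    · ext j
      simp
      ring
  have hQeq : Q = Polynomial.C c * Polynomial.X ^ (d + 1) := by
    refine Polynomial.eq_of_infinite_eval_eq _ _ (Set.Infinite.mono (s := {0}ᶜ) ?_
      (Set.finite_singleton (0 : ℂ)).infinite_compl)
    intro t ht
    simp only [Set.mem_ofPred_eq, hQe, hline t ht, Polynomial.eval_mul, Polynomial.eval_C,
      Polynomial.eval_pow, Polynomial.eval_X]
  have h0 := hQe 0
  rw [hQeq] at h0
  simp only [Polynomial.eval_mul, Polynomial.eval_C, Polynomial.eval_pow, Polynomial.eval_X,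
    zero_mul, add_zero, aeval_ofReal] at h0
  simp at h0
  exact hFa (by exact_mod_cast h0.symm)

lemma exists_line_roots {F : MvPolynomial σ ℝ} {d : ℕ} (hF : F.IsHomogeneous d)
    (hs : IsStable F) (hnn : ∀ m, 0 ≤ coeff m F) (h0 : F ≠ 0) {a y : σ → ℝ}
    (ha : ∀ j, 0 < a j) (hy : ∀ j, 0 < y j) :
    ∃ μ : Multiset ℝ, Multiset.card μ ≤ d ∧ (∀ x ∈ μ, 0 < x) ∧
      (∀ t : ℝ, eval (fun j => y j + a j * t) F = eval y F * (μ.map fun x => 1 + t * x).prod) ∧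
      eval y (dirDeriv a F) = eval y F * μ.sum := by
  set P := lineRestrict (fun j => (y j : ℂ)) a F with hP
  have hPe : ∀ t : ℝ, P.eval (t : ℂ) = (eval (fun j => y j + a j * t) F : ℝ) := by
    intro t
    rw [hP, eval_lineRestrict, ← aeval_ofReal]
    congr 2
    ext j
    push_cast
    ring
  have hy0 := eval_pos_of_coeff_nonneg hnn h0 hy
  have hP0 : P.eval 0 = (eval y F : ℝ) := by simpa using hPe 0
  have hPne : P.eval 0 ≠ 0 := by rw [hP0]; exact_mod_cast hy0.ne'
  have hder : P.derivative.eval 0 = (eval y (dirDeriv a F) : ℝ) := by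
    rw [hP, derivative_lineRestrict, eval_lineRestrict, ← aeval_ofReal]
    simp
  have hroots : ∀ ρ ∈ P.roots, ρ.im = 0 ∧ ρ.re < 0 := by
    intro ρ hρ
    have h1 := Polynomial.isRoot_of_mem_roots hρ
    have h1' := h1
    rw [Polynomial.IsRoot, hP, eval_lineRestrict] at h1
    have him : ρ.im = 0 := by
      rcases lt_trichotomy ρ.im 0 with h | h | h
      · exfalso
        have h2 := aeval_smul_of_isHomogeneous hF (-1 : ℂ) (fun j => (y j : ℂ) + a j * ρ)
        rw [h1, mul_zero] at h2
        refine hs _ (fun j => ?_) h2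
        have := mul_pos (ha j) (neg_pos.2 h)
        simp
        linarith
      · exact h
      · exfalso
        refine hs _ (fun j => ?_) h1
        have := mul_pos (ha j) h
        simpa using this
    refine ⟨him, ?_⟩
    by_contra hc
    push Not at hc
    have hρ' : ρ = (ρ.re : ℂ) := by apply Complex.ext <;> simp [him]
    rw [Polynomial.IsRoot, hρ', hPe] at h1'
    have := eval_pos_of_coeff_nonneg hnn h0 (y := fun j => y j + a j * ρ.re)
      (fun j => add_pos_of_pos_of_nonneg (hy j) (mul_nonneg (ha j).le hc))
    exact this.ne' (by exact_mod_cast h1')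
  have hsplit := IsAlgClosed.splits P
  set μ : Multiset ℝ := P.roots.map fun ρ => (-ρ.re)⁻¹ with hμ
  refine ⟨μ, ?_, ?_, ?_, ?_⟩
  · rw [hμ, Multiset.card_map]
    exact (Polynomial.card_roots' P).trans (natDegree_lineRestrict_le _ _ hF)
  · intro x hx
    obtain ⟨ρ, hρ, rfl⟩ := Multiset.mem_map.1 hx
    exact inv_pos.2 (neg_pos.2 (hroots ρ hρ).2)
  · intro t
    have e1 := hsplit.eval_eq_prod_roots (t : ℂ)
    have e0 := hsplit.eval_eq_prod_roots (0 : ℂ)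
    have e2 : (P.roots.map fun ρ => ((t : ℂ) - ρ)).prod =
        (P.roots.map fun ρ => ((0 : ℂ) - ρ)).prod *
          (((μ.map fun x => 1 + t * x).prod : ℝ) : ℂ) := by
      have e3 : (((μ.map fun x => 1 + t * x).prod : ℝ) : ℂ) =
          (P.roots.map fun ρ => ((1 + t * (-ρ.re)⁻¹ : ℝ) : ℂ)).prod := by
        have := map_multiset_prod Complex.ofRealHom (μ.map fun x => 1 + t * x)
        rw [hμ, Multiset.map_map, Multiset.map_map] at this
        rw [hμ, Multiset.map_map]
        exact this
      rw [e3, ← Multiset.prod_map_mul]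
      congr 1
      refine Multiset.map_congr rfl fun ρ hρ => ?_
      obtain ⟨h1, h2⟩ := hroots ρ hρ
      have hρ' : ρ = (ρ.re : ℂ) := by apply Complex.ext <;> simp [h1]
      rw [hρ', Complex.ofReal_re]
      have : (ρ.re : ℂ) ≠ 0 := by exact_mod_cast h2.ne
      push_cast
      field_simp
      ring
    rw [e2, ← mul_assoc, ← e0, hPe, hP0] at e1
    exact_mod_cast e1
  · have hsum := hsplit.eval_derivative_eq_eval_mul_sum hPne
    have e2 : (P.roots.map fun z ↦ 1 / (0 - z)).sum = ((μ.sum : ℝ) : ℂ) := by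
      have := map_multiset_sum Complex.ofRealHom μ
      rw [hμ, Multiset.map_map] at this
      rw [hμ]
      refine Eq.trans ?_ this.symm
      congr 1
      refine Multiset.map_congr rfl fun ρ hρ => ?_
      obtain ⟨h1, h2⟩ := hroots ρ hρ
      have hρ' : ρ = (ρ.re : ℂ) := by apply Complex.ext <;> simp [h1]
      rw [hρ']
      simp
    rw [e2, hder, hP0] at hsum
    exact_mod_cast hsum

lemma multiset_prod_one_add_le (μ : Multiset ℝ) (hμ : ∀ x ∈ μ, 0 < x) {d : ℕ} (hd : 0 < d)
    (hc : Multiset.card μ ≤ d) {t : ℝ} (ht : 0 ≤ t) :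
    (μ.map fun x => 1 + t * x).prod ≤ (1 + t * μ.sum / d) ^ d := by
  set L : List ℝ := (μ.map (fun x => 1 + t * x) + Multiset.replicate (d - Multiset.card μ) 1).toList
    with hL
  have hlen : L.length = d := by
    simp [hL]; omega
  have hpos : ∀ i : Fin L.length, 0 ≤ L[i.1] := by
    intro i
    have h1 : L[i.1] ∈ L := List.getElem_mem _
    generalize L[i.1] = v at h1
    rw [hL, Multiset.mem_toList, Multiset.mem_add] at h1
    rcases h1 with h | h
    · obtain ⟨x, hx, rfl⟩ := Multiset.mem_map.1 h
      have := mul_nonneg ht (hμ x hx).le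
      linarith
    · rw [Multiset.eq_of_mem_replicate h]; exact zero_le_one
  have h := prod_le_sum_div_card_pow univ (fun i : Fin L.length => L[i.1]) (fun i _ => hpos i)
  rw [Fin.prod_univ_getElem, Fin.sum_univ_getElem, card_univ, Fintype.card_fin, hlen] at h
  have hprod : L.prod = (μ.map fun x => 1 + t * x).prod := by
    rw [hL, Multiset.prod_toList]; simp
  have hsum : L.sum = d + t * μ.sum := by
    rw [hL, Multiset.sum_toList]
    have hm : (μ.map fun x => t * x).sum = t * μ.sum := by
      simpa using Multiset.sum_map_mul_left (s := μ) (a := t) (f := id)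
    simp only [Multiset.sum_add, Multiset.sum_map_add, hm, Multiset.sum_replicate,
      Multiset.map_const', nsmul_eq_mul, mul_one, Nat.cast_sub hc]
    ring
  have hdr : (d : ℝ) ≠ 0 := by exact_mod_cast hd.ne'
  rw [hprod, hsum, add_div, div_self hdr] at h
  exact h

lemma dirDeriv_eq_sum [Fintype σ] (a : σ → ℝ) (F : MvPolynomial σ ℝ) :
    dirDeriv a F = ∑ j, a j • pderiv j F := by
  classical
  have h : dirDeriv a = ∑ j, a j • (pderiv j : Derivation ℝ (MvPolynomial σ ℝ) _) := by
    refine derivation_ext fun i => ?_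
    rw [← Derivation.coeFnAddMonoidHom_apply (∑ j, _), map_sum, Finset.sum_apply]
    simp only [Derivation.coeFnAddMonoidHom_apply, Derivation.coe_smul, Pi.smul_apply, pderiv_X]
    rw [sum_eq_single i (fun j _ hj => by rw [Pi.single_eq_of_ne hj.symm, smul_zero])
      (by simp), Pi.single_eq_same]
    have : dirDeriv a (X i) = C (a i) := mkDerivation_X _ _ _
    rw [this, smul_eq_C_mul, mul_one]
  rw [h, ← Derivation.coeFnAddMonoidHom_apply, map_sum, Finset.sum_apply]
  simp

lemma isHomogeneous_dirDeriv [Fintype σ] (a : σ → ℝ) {F : MvPolynomial σ ℝ} {d : ℕ}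
    (hF : F.IsHomogeneous (d + 1)) : (dirDeriv a F).IsHomogeneous d := by
  rw [dirDeriv_eq_sum]
  refine IsHomogeneous.sum _ _ _ fun j _ => ?_
  rw [smul_eq_C_mul]
  have h := (isHomogeneous_C σ (a j)).mul (hF.pderiv (i := j))
  simpa using h

lemma coeff_pderiv_nonneg {F : MvPolynomial σ ℝ} (hF : ∀ m, 0 ≤ coeff m F) (j : σ) (m : σ →₀ ℕ) :
    0 ≤ coeff m (pderiv j F) := by
  rw [coeff_pderiv]
  exact mul_nonneg (hF _) (by positivity)

lemma coeff_dirDeriv_nonneg [Fintype σ] {a : σ → ℝ} (ha : ∀ j, 0 < a j) {F : MvPolynomial σ ℝ}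
    (hF : ∀ m, 0 ≤ coeff m F) (m : σ →₀ ℕ) : 0 ≤ coeff m (dirDeriv a F) := by
  rw [dirDeriv_eq_sum, coeff_sum]
  refine sum_nonneg fun j _ => ?_
  rw [coeff_smul]
  exact mul_nonneg (ha j).le (coeff_pderiv_nonneg hF j m)

lemma eval_eq_of_isHomogeneous_zero {F : MvPolynomial σ ℝ} (hF : F.IsHomogeneous 0)
    (x y : σ → ℝ) : eval x F = eval y F := by
  rw [← totalDegree_zero_iff_isHomogeneous, totalDegree_eq_zero_iff_eq_C] at hF
  rw [hF, eval_C, eval_C]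

lemma eval_dirDeriv_self [Fintype σ] {F : MvPolynomial σ ℝ} {d : ℕ} (hF : F.IsHomogeneous d)
    (a : σ → ℝ) : eval a (dirDeriv a F) = d * eval a F := by
  have h := congrArg (eval a) hF.sum_X_mul_pderiv
  rw [map_sum] at h
  rw [dirDeriv_eq_sum, map_sum]
  simpa [smul_eval] using h

/-- One step of Gurvits' capacity argument. -/
lemma capacity_dirDeriv [Fintype σ] {l : ℕ} {F : MvPolynomial σ ℝ} (hF : F.IsHomogeneous (l + 1))
    (hs : IsStable F) (hnn : ∀ m, 0 ≤ coeff m F) (h0 : F ≠ 0) {a : Fin (l + 1) → σ → ℝ}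
    (ha : ∀ i j, 0 < a i j) {γ : ℝ} (hγ : 0 < γ)
    (hcap : ∀ z : Fin (l + 1) → ℝ, (∀ i, 0 < z i) →
      γ * ∏ i, z i ≤ eval (fun j => ∑ i, z i * a i j) F)
    (z : Fin l → ℝ) (hz : ∀ i, 0 < z i) :
    γ * ((l : ℝ) / (l + 1)) ^ l * ∏ i, z i ≤
      eval (fun j => ∑ i, z i * a i.succ j) (dirDeriv (a 0) F) := by
  rcases Nat.eq_zero_or_pos l with rfl | hl
  · have h1 := hcap (fun _ => 1) (fun _ => one_pos)
    have h2 := eval_dirDeriv_self hF (a 0)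
    rw [eval_eq_of_isHomogeneous_zero (isHomogeneous_dirDeriv (a 0) hF) _ (a 0), h2]
    simp only [prod_const_one, mul_one, one_mul] at h1
    simpa using h1
  have : Nonempty (Fin l) := ⟨⟨0, hl⟩⟩
  have hlr : (0 : ℝ) < l := by exact_mod_cast hl
  set y : σ → ℝ := fun j => ∑ i, z i * a i.succ j with hy
  have hypos : ∀ j, 0 < y j := fun j =>
    sum_pos (fun i _ => mul_pos (hz i) (ha _ _)) univ_nonempty
  obtain ⟨μ, hcard, hμ, hline, hder⟩ := exists_line_roots hF hs hnn h0 (ha 0) hypos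
  have hFy := eval_pos_of_coeff_nonneg hnn h0 hypos
  set zp := ∏ i, z i with h_zp
  have hzppos : 0 < zp := prod_pos fun i _ => hz i
  have hbound : ∀ t : ℝ, 0 < t →
      γ * (t * zp) ≤ eval y F * (1 + t * μ.sum / ((l + 1 : ℕ) : ℝ)) ^ (l + 1) := by
    intro t ht
    have h1 := hcap (Fin.cons t z) (fun i => by
      refine Fin.cases ?_ (fun i => ?_) i
      · simpa using ht
      · simpa using hz i)
    rw [Fin.prod_univ_succ] at h1
    simp only [Fin.cons_zero, Fin.cons_succ, Fin.sum_univ_succ] at h1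
    have h2 : (fun j => t * a 0 j + ∑ i, z i * a i.succ j) = fun j => y j + a 0 j * t := by
      ext j; rw [hy]; ring
    rw [h2, hline] at h1
    exact h1.trans (mul_le_mul_of_nonneg_left
      (multiset_prod_one_add_le μ hμ (Nat.succ_pos l) hcard ht.le) hFy.le)
  have hsum0 : 0 ≤ μ.sum := Multiset.sum_nonneg fun x hx => (hμ x hx).le
  have hsum : 0 < μ.sum := by
    refine lt_of_le_of_ne hsum0 fun h => ?_
    have h1 := hbound ((eval y F + 1) / (γ * zp)) (by positivity)
    rw [← h, mul_zero, zero_div, add_zero, one_pow, mul_one] at h1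
    have : γ * ((eval y F + 1) / (γ * zp) * zp) = eval y F + 1 := by field_simp
    linarith
  have h1 := hbound ((l + 1) / (l * μ.sum)) (by positivity)
  have e1 : 1 + ((l : ℝ) + 1) / (l * μ.sum) * μ.sum / ((l + 1 : ℕ) : ℝ) = (l + 1) / l := by
    push_cast; field_simp
  rw [e1] at h1
  rw [hder]
  have h2 := mul_le_mul_of_nonneg_right h1
    (show 0 ≤ ((l : ℝ) / (l + 1)) ^ (l + 1) * μ.sum by positivity)
  have e2 : eval y F * (((l : ℝ) + 1) / l) ^ (l + 1) * (((l : ℝ) / (l + 1)) ^ (l + 1) * μ.sum) =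
      eval y F * μ.sum := by
    have : (((l : ℝ) + 1) / l) ^ (l + 1) * ((l : ℝ) / (l + 1)) ^ (l + 1) = 1 := by
      rw [← mul_pow, div_mul_div_comm, mul_comm, div_self (by positivity), one_pow]
    linear_combination (eval y F * μ.sum) * this
  have e3 : γ * (((l : ℝ) + 1) / (l * μ.sum) * zp) * (((l : ℝ) / (l + 1)) ^ (l + 1) * μ.sum) =
      γ * ((l : ℝ) / (l + 1)) ^ l * zp := by
    rw [pow_succ]; field_simp
  rw [e2, e3] at h2
  exact h2

/-- Iterated directional derivatives. -/
noncomputable def iterDirDeriv : (l : ℕ) → (Fin l → σ → ℝ) →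
    (MvPolynomial σ ℝ →ₗ[ℝ] MvPolynomial σ ℝ)
  | 0, _ => LinearMap.id
  | l + 1, a => iterDirDeriv l (fun i => a i.succ) ∘ₗ (dirDeriv (a 0)).toLinearMap

lemma iterDirDeriv_succ (l : ℕ) (a : Fin (l + 1) → σ → ℝ) (F : MvPolynomial σ ℝ) :
    iterDirDeriv (l + 1) a F = iterDirDeriv l (fun i => a i.succ) (dirDeriv (a 0) F) := rfl

lemma capacity_iterDirDeriv [Fintype σ] (l : ℕ) : ∀ (F : MvPolynomial σ ℝ),
    F.IsHomogeneous l → IsStable F → (∀ m, 0 ≤ coeff m F) → F ≠ 0 →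
    ∀ a : Fin l → σ → ℝ, (∀ i j, 0 < a i j) → ∀ γ : ℝ, 0 < γ →
    (∀ z : Fin l → ℝ, (∀ i, 0 < z i) →
      γ * ∏ i, z i ≤ eval (fun j => ∑ i, z i * a i j) F) → ∀ x : σ → ℝ,
    γ * (l.factorial / (l : ℝ) ^ l) ≤ eval x (iterDirDeriv l a F) := by
  induction l with
  | zero =>
    intro F hF _ _ _ a _ γ _ hcap x
    have h1 := hcap (fun _ => 1) (fun _ => one_pos)
    simpa [iterDirDeriv, eval_eq_of_isHomogeneous_zero hF x (fun _ => 0)] using h1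
  | succ l ih =>
    intro F hF hs hnn h0 a ha γ hγ hcap x
    have hcap' := capacity_dirDeriv hF hs hnn h0 ha hγ hcap
    have hγ' : 0 < γ * ((l : ℝ) / (l + 1)) ^ l := by
      rcases Nat.eq_zero_or_pos l with rfl | hl
      · simpa using hγ
      · have : (0 : ℝ) < l := by exact_mod_cast hl
        positivity
    have hne : dirDeriv (a 0) F ≠ 0 := by
      intro h
      have := hcap' (fun _ => 1) (fun _ => one_pos)
      rw [h, map_zero, prod_const_one, mul_one] at this
      linarith
    have h := ih (dirDeriv (a 0) F) (isHomogeneous_dirDeriv _ hF)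
      (stable_dirDeriv hF hs (ha 0) (eval_pos_of_coeff_nonneg hnn h0 (ha 0)).ne')
      (coeff_dirDeriv_nonneg (ha 0) hnn) hne (fun i => a i.succ) (fun i => ha _) _ hγ' hcap' x
    rw [iterDirDeriv_succ]
    convert h using 1
    rcases Nat.eq_zero_or_pos l with rfl | hl
    · simp
    have : (0 : ℝ) < l := by exact_mod_cast hl
    rw [Nat.factorial_succ, pow_succ, div_pow]
    push_cast
    field_simp

lemma continuous_eval_iterDirDeriv [Fintype σ] (l : ℕ) (x : σ → ℝ) : ∀ F : MvPolynomial σ ℝ,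
    Continuous fun a : Fin l → σ → ℝ => eval x (iterDirDeriv l a F) := by
  induction l with
  | zero => intro F; exact continuous_const (y := eval x F)
  | succ l ih =>
    intro F
    have : (fun a : Fin (l + 1) → σ → ℝ => eval x (iterDirDeriv (l + 1) a F)) =
        fun a => ∑ j, a 0 j * eval x (iterDirDeriv l (fun i => a i.succ) (pderiv j F)) := by
      ext a
      rw [iterDirDeriv_succ, dirDeriv_eq_sum, map_sum, map_sum]
      simp [smul_eval]
    rw [this]
    refine continuous_finsetSum (M := ℝ) univ fun j _ => ?_
    have h0 : Continuous fun a : Fin (l + 1) → σ → ℝ => a 0 j := by fun_prop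
    exact h0.mul ((ih (pderiv j F)).comp (g := fun a : Fin l → σ → ℝ => eval x (iterDirDeriv l a _))
      (f := fun a : Fin (l + 1) → σ → ℝ => fun i => a i.succ) (by fun_prop))

lemma coeff_iterDirDeriv_single [Fintype σ] [DecidableEq σ] (l : ℕ) :
    ∀ (js : Fin l → σ) (F : MvPolynomial σ ℝ) (m : σ →₀ ℕ),
    coeff m (iterDirDeriv l (fun i => Pi.single (js i) 1) F) * ∏ j, ((m j).factorial : ℝ) =
      (∏ j, (((m + ∑ i, Finsupp.single (js i) 1 : σ →₀ ℕ) j).factorial : ℝ)) *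
        coeff (m + ∑ i, Finsupp.single (js i) 1) F := by
  induction l with
  | zero => intro js F m; simp [iterDirDeriv, mul_comm]
  | succ l ih =>
    intro js F m
    have hd : dirDeriv (Pi.single (js 0) 1) F = pderiv (js 0) F := by
      rw [dirDeriv_eq_sum, sum_eq_single (js 0)]
      · simp
      · intro j _ hj
        rw [Pi.single_eq_of_ne hj, zero_smul]
      · simp
    rw [iterDirDeriv_succ, hd, ih (fun i => js i.succ), coeff_pderiv, Fin.sum_univ_succ]
    set c := m + ∑ i, Finsupp.single (js (Fin.succ i)) 1 with hc
    have e : m + (Finsupp.single (js 0) 1 + ∑ i, Finsupp.single (js (Fin.succ i)) 1) =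
        c + Finsupp.single (js 0) 1 := by rw [hc]; abel
    rw [e]
    have e2 : ∏ j, (((c + Finsupp.single (js 0) 1 : σ →₀ ℕ) j).factorial : ℝ) =
        (∏ j, ((c j).factorial : ℝ)) * (c (js 0) + 1) := by
      rw [← mul_prod_erase univ _ (mem_univ (js 0)),
        ← mul_prod_erase univ (fun j => ((c j).factorial : ℝ)) (mem_univ (js 0))]
      have : ∀ j ∈ univ.erase (js 0), (((c + Finsupp.single (js 0) 1 : σ →₀ ℕ) j).factorial : ℝ) =
          ((c j).factorial : ℝ) := by
        intro j hj
        simp [(ne_of_mem_erase hj).symm]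
      rw [prod_congr rfl this]
      simp [Nat.factorial_succ]
      ring
    rw [e2]
    ring

lemma exists_fiber_card {n N : ℕ} (c : Fin n → ℕ) (hc : ∑ j, c j = N) :
    ∃ js : Fin N → Fin n, ∀ j, #{i | js i = j} = c j := by
  subst hc
  refine ⟨fun i => (finSigmaFinEquiv.symm i).1, fun j => ?_⟩
  have h : ∀ i : Fin (∑ j, c j), (finSigmaFinEquiv.symm i).1 = j ↔
      ∃ k : Fin (c j), finSigmaFinEquiv ⟨j, k⟩ = i := by
    intro i
    constructor
    · rintro rfl
      exact ⟨(finSigmaFinEquiv.symm i).2, by simp⟩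
    · rintro ⟨k, rfl⟩
      simp
  have himg : ({i | (finSigmaFinEquiv.symm i).1 = j} : Finset (Fin (∑ j, c j))) =
      univ.image fun k : Fin (c j) => finSigmaFinEquiv ⟨j, k⟩ := by
    ext i
    simp only [mem_filter, mem_univ, true_and, mem_image, h]
  rw [himg, card_image_of_injective, card_univ, Fintype.card_fin]
  intro k k' hkk
  simpa using hkk

/-- Gurvits' lower bound for a coefficient of a stable polynomial in terms of its capacity. -/
lemma gurvits_coeff_bound {n N : ℕ} {F : MvPolynomial (Fin n) ℝ} (hF : F.IsHomogeneous N)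
    (hs : IsStable F) (hnn : ∀ m, 0 ≤ coeff m F) (c : Fin n →₀ ℕ) (hc : ∑ j, c j = N) {γ : ℝ}
    (hγ : 0 ≤ γ) (hcap : ∀ y : Fin n → ℝ, (∀ j, 0 < y j) → γ * ∏ j, y j ^ c j ≤ eval y F) :
    γ * ((N.factorial / (N : ℝ) ^ N) * ∏ j, ((c j : ℝ) ^ c j / ((c j).factorial : ℝ))) ≤
      coeff c F := by
  rcases hγ.eq_or_lt with rfl | hγ
  · simpa using hnn c
  have h0 : F ≠ 0 := by
    rintro rfl
    have := hcap (fun _ => 1) (fun _ => one_pos)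
    simp only [one_pow, prod_const_one, mul_one, map_zero] at this
    linarith
  obtain ⟨js, hjs⟩ := exists_fiber_card (fun j => c j) hc
  have hcs : c = ∑ i, Finsupp.single (js i) 1 := by
    ext j
    rw [Finsupp.finsetSum_apply]
    simp only [Finsupp.single_apply]
    rw [sum_boole, hjs j]
    simp
  have hpp : 0 < ∏ j, (c j : ℝ) ^ c j := prod_pos fun j _ => by
    rcases Nat.eq_zero_or_pos (c j) with h | h
    · rw [h, pow_zero]; exact one_pos
    · have : (0 : ℝ) < c j := by exact_mod_cast h
      positivity
  have hAG : ∀ z : Fin N → ℝ, (∀ i, 0 < z i) → ∀ y : Fin n → ℝ,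
      (∀ j, ∑ i with js i = j, z i ≤ y j) →
      (∏ j, (c j : ℝ) ^ c j) * ∏ i, z i ≤ ∏ j, y j ^ c j := by
    intro z hz y hy
    rw [← prod_fiberwise_of_maps_to (s := univ) (t := univ) (g := js) (fun i _ => mem_univ _),
      ← prod_mul_distrib]
    refine prod_le_prod (fun j _ => mul_nonneg (by positivity) (prod_nonneg fun i _ => (hz i).le))
      fun j _ => ?_
    have h1 := prod_le_sum_div_card_pow {i | js i = j} z (fun i _ => (hz i).le)
    have hs0 : 0 ≤ ∑ i with js i = j, z i := sum_nonneg fun i _ => (hz i).le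
    rw [hjs j] at h1
    calc (c j : ℝ) ^ c j * ∏ i with js i = j, z i
        ≤ (c j : ℝ) ^ c j * ((∑ i with js i = j, z i) / c j) ^ c j :=
          mul_le_mul_of_nonneg_left h1 (by positivity)
      _ = (∑ i with js i = j, z i) ^ c j := by
          rcases Nat.eq_zero_or_pos (c j) with h | h
          · simp [h]
          · have : (0 : ℝ) < c j := by exact_mod_cast h
            rw [← mul_pow, mul_div_cancel₀ _ this.ne']
      _ ≤ y j ^ c j := pow_le_pow_left₀ hs0 (hy j) _
  have hε : ∀ ε : ℝ, 0 < ε → (γ * ∏ j, (c j : ℝ) ^ c j) * (N.factorial / (N : ℝ) ^ N) ≤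
      eval 0 (iterDirDeriv N (fun i => Pi.single (js i) 1 + fun _ => ε) F) := by
    intro ε hε
    have hsn : ∀ i j, (0 : ℝ) ≤ (Pi.single (js i) 1 : Fin n → ℝ) j := fun i j => by
      rw [Pi.single_apply]; split_ifs <;> norm_num
    refine capacity_iterDirDeriv N F hF hs hnn h0 _ (fun i j => ?_) _ (mul_pos hγ hpp)
      (fun z hz => ?_) 0
    · have := hsn i j
      simp only [Pi.add_apply]; linarith
    · rcases Nat.eq_zero_or_pos N with hN | hN
      · subst hN
        have hc0 : ∀ j, c j = 0 := fun j => by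
          have := hjs j
          rw [← this, card_eq_zero, filter_eq_empty_iff]
          exact fun i => i.elim0
        have h1 := hcap (fun _ => 1) (fun _ => one_pos)
        rw [eval_eq_of_isHomogeneous_zero hF _ (fun _ => 1)]
        simpa [hc0] using h1
      have : Nonempty (Fin N) := ⟨⟨0, hN⟩⟩
      refine le_trans ?_ (hcap _ fun j => sum_pos (fun i _ => mul_pos (hz i) ?_) univ_nonempty)
      · rw [mul_assoc]
        refine mul_le_mul_of_nonneg_left (hAG z hz _ fun j => ?_) hγ.le
        rw [sum_filter]
        refine sum_le_sum fun i _ => ?_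
        simp only [Pi.add_apply, Pi.single_apply]
        have := hz i
        have := mul_pos this hε
        by_cases h : js i = j
        · rw [if_pos h, if_pos h.symm]; linarith
        · rw [if_neg h, if_neg (Ne.symm h)]; linarith
      · have := hsn i j
        simp only [Pi.add_apply]; linarith
  have hcont : Continuous fun ε : ℝ =>
      eval 0 (iterDirDeriv N (fun i => Pi.single (js i) 1 + fun _ => ε) F) :=
    (continuous_eval_iterDirDeriv N 0 F).comp (g := fun a : Fin N → Fin n → ℝ =>
      eval 0 (iterDirDeriv N a F))
      (f := fun ε : ℝ => fun i => (Pi.single (js i) 1 : Fin n → ℝ) + fun _ => ε) (by fun_prop)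
  have hlim : (γ * ∏ j, (c j : ℝ) ^ c j) * (N.factorial / (N : ℝ) ^ N) ≤
      eval 0 (iterDirDeriv N (fun i => Pi.single (js i) 1) F) := by
    have ht := (hcont.tendsto 0).mono_left (nhdsWithin_le_nhds (s := Set.Ioi 0))
    have e : (fun i => (Pi.single (js i) 1 : Fin n → ℝ) + fun _ => (0 : ℝ)) =
        fun i => Pi.single (js i) 1 := by
      ext i j; simp
    rw [e] at ht
    refine ge_of_tendsto ht ?_
    filter_upwards [self_mem_nhdsWithin] with ε h using hε ε h
  have hco := coeff_iterDirDeriv_single N js F 0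
  rw [zero_add, ← hcs] at hco
  have hcoef : eval 0 (iterDirDeriv N (fun i => Pi.single (js i) 1) F) =
      (∏ j, ((c j).factorial : ℝ)) * coeff c F := by
    rw [← hco]
    have : eval (0 : Fin n → ℝ) (iterDirDeriv N (fun i => Pi.single (js i) 1) F) =
        constantCoeff (iterDirDeriv N (fun i => Pi.single (js i) 1) F) := by
      rw [← eval_zero]
    rw [this, constantCoeff_eq]
    simp
  rw [hcoef] at hlim
  have hfac : 0 < ∏ j, ((c j).factorial : ℝ) := prod_pos fun j _ => by positivity
  rw [prod_div_distrib]
  have := div_le_div_of_nonneg_right hlim hfac.le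
  rw [mul_div_cancel_left₀ _ hfac.ne'] at this
  refine le_trans (le_of_eq ?_) this
  ring

end Gurvits

section CellInduction

open MvPolynomial

/-- A multivariate real polynomial with nonnegative coefficients. -/
def NonnegCoeff {σ : Type*} (F : MvPolynomial σ ℝ) : Prop := ∀ m, 0 ≤ coeff m F

variable {n : ℕ}

lemma NonnegCoeff.mul {F G : MvPolynomial (Fin n) ℝ} (hF : NonnegCoeff F) (hG : NonnegCoeff G) :
    NonnegCoeff (F * G) := fun m => by
  classical
  rw [coeff_mul]
  exact sum_nonneg fun x _ => mul_nonneg (hF _) (hG _)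

lemma NonnegCoeff.sum {ι : Type*} {s : Finset ι} {F : ι → MvPolynomial (Fin n) ℝ}
    (h : ∀ i ∈ s, NonnegCoeff (F i)) : NonnegCoeff (∑ i ∈ s, F i) := fun m => by
  rw [coeff_sum]
  exact sum_nonneg fun i hi => h i hi m

lemma nonnegCoeff_monomial (s : Fin n →₀ ℕ) {r : ℝ} (hr : 0 ≤ r) :
    NonnegCoeff (monomial s r) := fun m => by
  classical
  rw [coeff_monomial]
  split_ifs
  exacts [hr, le_rfl]

lemma nonnegCoeff_zero : NonnegCoeff (0 : MvPolynomial (Fin n) ℝ) := fun m => by simp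

lemma nonnegCoeff_C {r : ℝ} (hr : 0 ≤ r) : NonnegCoeff (C r : MvPolynomial (Fin n) ℝ) :=
  nonnegCoeff_monomial 0 hr

lemma nonnegCoeff_one : NonnegCoeff (1 : MvPolynomial (Fin n) ℝ) :=
  nonnegCoeff_C zero_le_one

lemma nonnegCoeff_X_pow (j : Fin n) (e : ℕ) :
    NonnegCoeff (X j ^ e : MvPolynomial (Fin n) ℝ) := by
  rw [X_pow_eq_monomial]
  exact nonnegCoeff_monomial _ zero_le_one

lemma eval_nonneg_of_nonnegCoeff {F : MvPolynomial (Fin n) ℝ} (hF : NonnegCoeff F)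
    {y : Fin n → ℝ} (hy : ∀ j, 0 < y j) : 0 ≤ eval y F := by
  rcases eq_or_ne F 0 with rfl | h
  · simp
  · exact (eval_pos_of_coeff_nonneg hF h hy).le

/-- The generating polynomial of the rows with entries in the columns of a list, weights `w` and
a given sum. -/
noncomputable def rowPoly (w : Fin n → ℝ) : List (Fin n) → ℕ → MvPolynomial (Fin n) ℝ
  | [], ρ => if ρ = 0 then 1 else 0
  | j :: J, ρ => ∑ v ∈ range (ρ + 1), C (w j ^ (ρ - v)) * X j ^ (ρ - v) * rowPoly w J v

lemma nonnegCoeff_rowPoly {w : Fin n → ℝ} (hw : ∀ j, 0 ≤ w j) (J : List (Fin n)) :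
    ∀ ρ, NonnegCoeff (rowPoly w J ρ) := by
  induction J with
  | nil =>
    intro ρ
    rw [rowPoly]
    split_ifs
    exacts [nonnegCoeff_one, nonnegCoeff_zero]
  | cons j J ih =>
    intro ρ
    rw [rowPoly]
    exact NonnegCoeff.sum fun v _ =>
      ((nonnegCoeff_C (pow_nonneg (hw j) _)).mul (nonnegCoeff_X_pow j _)).mul (ih v)

lemma coeff_mul_rowPoly_cons (w : Fin n → ℝ) (j : Fin n) (J : List (Fin n)) (c : Fin n →₀ ℕ)
    (p Q : MvPolynomial (Fin n) ℝ) {ρ B : ℕ} (hB : ρ < B) :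
    coeff c (p * (rowPoly w (j :: J) ρ * Q)) = ∑ v ∈ range B,
      if v ≤ ρ then w j ^ (ρ - v) * coeff c (p * X j ^ (ρ - v) * (rowPoly w J v * Q)) else 0 := by
  have h1 : p * (rowPoly w (j :: J) ρ * Q) =
      ∑ v ∈ range (ρ + 1), C (w j ^ (ρ - v)) * (p * X j ^ (ρ - v) * (rowPoly w J v * Q)) := by
    rw [rowPoly, sum_mul, mul_sum]
    exact sum_congr rfl fun v _ => by ring
  rw [h1, coeff_sum, ← sum_filter]
  have h2 : ({v ∈ range B | v ≤ ρ} : Finset ℕ) = range (ρ + 1) := by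
    ext v; simp only [mem_filter, mem_range]; omega
  rw [h2]
  exact sum_congr rfl fun v _ => by rw [coeff_C_mul]

/-- The share of world `l` when `U` units are split evenly among `M` worlds. -/
def share (M U l : ℕ) : ℕ := (U + l) / M

/-- The number of worlds having the same share as world `l`. -/
def mult (M U l : ℕ) : ℕ := #{l' ∈ range M | share M U l' = share M U l}

/-- The invariant of the cell-by-cell induction. -/
structure Admissible (M U rest N : ℕ) (f : ℕ → MvPolynomial (Fin n) ℝ) (G : Fin n →₀ ℕ)
    (γ : ℝ) : Prop where
  nonneg : ∀ v, NonnegCoeff (f v)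
  zero : ∀ v, v ∉ (range M).image (share M U) → f v = 0
  hom : ∀ l < M, ∃ d, d + share M U l + rest = N ∧ (f (share M U l)).IsHomogeneous d
  ne_zero : ∀ z : Fin n → ℂ, (∀ j, 0 < (z j).im) → aeval z (f (U / M)) ≠ 0
  im_le : ∀ z : Fin n → ℂ, (∀ j, 0 < (z j).im) →
    (aeval z (f (U / M + 1)) / aeval z (f (U / M)) : ℂ).im ≤ 0
  pos : 0 < γ
  cap : ∀ (y : Fin n → ℝ) (x : ℕ → ℝ), (∀ j, 0 < y j) → (∀ l < M, 0 < x (share M U l)) →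
    γ * (∏ j, y j ^ G j) * ∏ l ∈ range M, x (share M U l) ≤
      (∑ v ∈ (range M).image (share M U), eval y (f v) * x v) ^ M

lemma prod_card_fiber_mul_le {s : Finset ℕ} (ρ : ℕ → ℕ) (a : ℕ → ℝ) (ha : ∀ l ∈ s, 0 ≤ a l) :
    ∏ l ∈ s, ((#{l' ∈ s | ρ l' = ρ l} : ℝ) * a l) ≤
      ∏ l ∈ s, ∑ l' ∈ s with ρ l' = ρ l, a l' := by
  have hmap : ∀ l ∈ s, ρ l ∈ s.image ρ := fun l hl => mem_image_of_mem ρ hl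
  rw [← prod_fiberwise_of_maps_to hmap, ← prod_fiberwise_of_maps_to hmap]
  have hnn : ∀ v, ∀ l ∈ ({l ∈ s | ρ l = v} : Finset ℕ), 0 ≤ a l :=
    fun v l hl => ha l (mem_filter.1 hl).1
  refine prod_le_prod (fun v _ => prod_nonneg fun l hl =>
    mul_nonneg (Nat.cast_nonneg _) (hnn v l hl)) fun v _ => ?_
  have e1 : ∏ l ∈ s with ρ l = v, ((#{l' ∈ s | ρ l' = ρ l} : ℝ) * a l) =
      (#{l' ∈ s | ρ l' = v} : ℝ) ^ #{l' ∈ s | ρ l' = v} * ∏ l ∈ s with ρ l = v, a l := by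
    rw [← prod_const, ← prod_mul_distrib]
    exact prod_congr rfl fun l hl => by rw [(mem_filter.1 hl).2]
  have e2 : ∏ l ∈ s with ρ l = v, ∑ l' ∈ s with ρ l' = ρ l, a l' =
      (∑ l' ∈ s with ρ l' = v, a l') ^ #{l' ∈ s | ρ l' = v} := by
    rw [← prod_const]
    exact prod_congr rfl fun l hl => by rw [(mem_filter.1 hl).2]
  rw [e1, e2]
  refine (mul_le_mul_of_nonneg_left (prod_le_sum_div_card_pow _ a (hnn v)) (by positivity)).trans
    (le_of_eq ?_)
  by_cases h : #{l' ∈ s | ρ l' = v} = 0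
  · rw [h]; simp
  · have : (#{l' ∈ s | ρ l' = v} : ℝ) ≠ 0 := by exact_mod_cast h
    rw [← mul_pow, mul_div_cancel₀ _ this]

lemma im_div_step_of_left {A B y : ℂ} (hA : A ≠ 0) (hB : (B / A).im ≤ 0) (hy : 0 < y.im)
    {p q r : ℝ} (hp : 0 < p) (hq : 0 ≤ q) (hr : 0 ≤ r) :
    p * A + q * (y * B) ≠ 0 ∧ (r * B / (p * A + q * (y * B))).im ≤ 0 := by
  set β := B / A with hβ
  have hBA : B = β * A := by rw [hβ, div_mul_cancel₀ _ hA]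
  set D : ℂ := p + q * (y * β) with hD
  have hDA : p * A + q * (y * B) = D * A := by rw [hBA, hD]; ring
  have hcalc : (β * (starRingEnd ℂ) D).im = p * β.im - q * Complex.normSq β * y.im := by
    rw [hD, Complex.normSq_apply]
    simp
    ring
  have hns := Complex.normSq_nonneg β
  have hle : (β * (starRingEnd ℂ) D).im ≤ 0 := by
    rw [hcalc]
    have h1 := mul_nonneg (mul_nonneg hq hns) hy.le
    nlinarith
  have hD0 : D ≠ 0 := by
    intro h
    rw [h] at hcalc
    simp only [map_zero, mul_zero, Complex.zero_im] at hcalc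
    have h1 := mul_nonneg (mul_nonneg hq hns) hy.le
    have h2 : p * β.im ≤ 0 := by nlinarith
    have h3 : q * Complex.normSq β * y.im = 0 := by linarith
    rw [mul_eq_zero, or_iff_left hy.ne', mul_eq_zero, Complex.normSq_eq_zero] at h3
    have h4 : D = p := by
      rcases h3 with h3 | h3 <;> simp [hD, h3]
    rw [h] at h4
    exact hp.ne (by exact_mod_cast h4)
  refine ⟨hDA ▸ mul_ne_zero hD0 hA, ?_⟩
  rw [hDA, hBA]
  have e : (r : ℂ) * (β * A) / (D * A) = ((r / Complex.normSq D : ℝ) : ℂ) *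
      (β * (starRingEnd ℂ) D) := by
    have hnD : (Complex.normSq D : ℂ) = D * (starRingEnd ℂ) D := (Complex.mul_conj D).symm
    have hcD : (starRingEnd ℂ) D ≠ 0 := (map_ne_zero _).2 hD0
    rw [Complex.ofReal_div, hnD]
    field_simp
  rw [e, Complex.im_ofReal_mul]
  exact mul_nonpos_of_nonneg_of_nonpos (div_nonneg hr (Complex.normSq_nonneg D)) hle

lemma im_div_step_of_right {A B y : ℂ} (hA : A ≠ 0) (hB : (B / A).im ≤ 0) (hy : 0 < y.im)
    {p q r : ℝ} (hp : 0 < p) (hq : 0 ≤ q) (hr : 0 ≤ r) :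
    p * (y * A) ≠ 0 ∧ ((q * A + r * (y * B)) / (p * (y * A))).im ≤ 0 := by
  have hy0 : y ≠ 0 := by rintro rfl; simp at hy
  have hpc : (p : ℂ) ≠ 0 := by exact_mod_cast hp.ne'
  refine ⟨mul_ne_zero hpc (mul_ne_zero hy0 hA), ?_⟩
  have e : (q * A + r * (y * B)) / (p * (y * A)) =
      ((q / p : ℝ) : ℂ) * y⁻¹ + ((r / p : ℝ) : ℂ) * (B / A) := by
    push_cast
    field_simp
  rw [e, Complex.add_im, Complex.im_ofReal_mul, Complex.im_ofReal_mul, Complex.inv_im]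
  have h1 : -y.im / Complex.normSq y ≤ 0 :=
    div_nonpos_of_nonpos_of_nonneg (by linarith) (Complex.normSq_nonneg y)
  exact add_nonpos (mul_nonpos_of_nonneg_of_nonpos (div_nonneg hq hp.le) h1)
    (mul_nonpos_of_nonneg_of_nonpos (div_nonneg hr hp.le) hB)

lemma share_mem {M : ℕ} (hM : 0 < M) (U : ℕ) {l : ℕ} (hl : l < M) :
    share M U l = U / M ∨ share M U l = U / M + 1 := by
  unfold share
  have h1 : U / M ≤ (U + l) / M := Nat.div_le_div_right (by omega)
  have h2 : (U + l) / M ≤ (U + M) / M := Nat.div_le_div_right (by omega)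
  rw [Nat.add_div_right _ hM] at h2
  omega

lemma share_mono_left (M : ℕ) {U U' : ℕ} (h : U' ≤ U) (l : ℕ) : share M U' l ≤ share M U l :=
  Nat.div_le_div_right (by omega)

lemma share_mono_right (M U : ℕ) {l l' : ℕ} (h : l ≤ l') : share M U l ≤ share M U l' :=
  Nat.div_le_div_right (by omega)

lemma sum_share_sub {M : ℕ} (hM : 0 < M) {U U' : ℕ} (h : U' ≤ U) :
    ∑ l ∈ range M, (share M U l - share M U' l) = U - U' := by
  rw [Finset.sum_tsub_distrib _ fun l _ => share_mono_left M h l]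
  unfold share
  rw [sum_range_add_div_eq M hM, sum_range_add_div_eq M hM]

lemma mult_pos {M : ℕ} (U : ℕ) {l : ℕ} (hl : l < M) : 0 < mult M U l :=
  card_pos.2 ⟨l, by simp [hl]⟩

/-- The invariant after the current cell has received its entries. -/
noncomputable def stepPoly (M U U' : ℕ) (lam : ℕ → ℝ) (j : Fin n)
    (f : ℕ → MvPolynomial (Fin n) ℝ) (v : ℕ) : MvPolynomial (Fin n) ℝ :=
  ∑ l ∈ range M with share M U' l = v,
    C (lam l) * (f (share M U l) * X j ^ (share M U l - share M U' l))

lemma aeval_stepPoly {M U U' : ℕ} (hM : 0 < M) (lam : ℕ → ℝ) (j : Fin n)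
    (f : ℕ → MvPolynomial (Fin n) ℝ) (v : ℕ) (z : Fin n → ℂ) :
    (aeval z (stepPoly M U U' lam j f v) : ℂ) =
      ((∑ l ∈ range M with share M U l = U / M ∧ share M U' l = v, lam l : ℝ) : ℂ) *
          (z j ^ (U / M - v) * aeval z (f (U / M))) +
        ((∑ l ∈ range M with share M U l = U / M + 1 ∧ share M U' l = v, lam l : ℝ) : ℂ) *
          (z j ^ (U / M + 1 - v) * aeval z (f (U / M + 1))) := by
  rw [stepPoly, map_sum]
  simp only [map_mul, map_pow, aeval_X, aeval_C, Complex.coe_algebraMap, Complex.ofReal_sum,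
    sum_mul, sum_filter]
  rw [← sum_add_distrib]
  refine sum_congr rfl fun l hl => ?_
  rcases share_mem hM U (mem_range.1 hl) with h | h
  · by_cases h' : share M U' l = v
    · simp [h, h']
      left
      ring
    · simp [h']
  · by_cases h' : share M U' l = v
    · simp [h, h']
      left
      ring
    · simp [h']

lemma Admissible.step {M U U' rest N : ℕ} {f : ℕ → MvPolynomial (Fin n) ℝ} {G : Fin n →₀ ℕ}
    {γ : ℝ} (hM : 0 < M) (hf : Admissible M U rest N f G γ) (hU : U' ≤ U) (j : Fin n)
    {lam : ℕ → ℝ} (hlam : ∀ l, 0 < lam l) :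
    Admissible M U' rest N (stepPoly M U U' lam j f) (G + Finsupp.single j (U - U'))
      (γ * ∏ l ∈ range M, ((mult M U l : ℝ) * lam l)) := by
  have stable : ∀ z : Fin n → ℂ, (∀ j, 0 < (z j).im) →
      aeval z (stepPoly M U U' lam j f (U' / M)) ≠ 0 ∧
      (aeval z (stepPoly M U U' lam j f (U' / M + 1)) /
        aeval z (stepPoly M U U' lam j f (U' / M)) : ℂ).im ≤ 0 := by
    intro z hz
    have hA := hf.ne_zero z hz
    have hB := hf.im_le z hz
    have hy0 : z j ≠ 0 := by
      intro h
      have := hz j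
      rw [h] at this
      simp at this
    have hqq : U' / M ≤ U / M := Nat.div_le_div_right hU
    obtain ⟨e, he⟩ := Nat.exists_eq_add_of_le hqq
    have hnn : ∀ w v, 0 ≤ ∑ l ∈ range M with share M U l = w ∧ share M U' l = v, lam l :=
      fun w v => sum_nonneg fun l _ => (hlam l).le
    have hp : 0 < ∑ l ∈ range M with share M U l = U / M ∧ share M U' l = U' / M, lam l :=
      sum_pos (fun l _ => hlam l) ⟨0, mem_filter.2 ⟨mem_range.2 hM, by simp [share]⟩⟩
    rw [aeval_stepPoly hM, aeval_stepPoly hM]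
    by_cases hz0 : ∑ l ∈ range M with share M U l = U / M ∧ share M U' l = U' / M + 1, lam l = 0
    · rw [hz0]
      have e1 : U / M - U' / M = e := by omega
      have e2 : U / M + 1 - U' / M = e + 1 := by omega
      have e3 : U / M + 1 - (U' / M + 1) = e := by omega
      rw [e1, e2, e3]
      obtain ⟨h1, h2⟩ := im_div_step_of_left hA hB (hz j) hp (hnn (U / M + 1) (U' / M))
        (hnn (U / M + 1) (U' / M + 1))
      have hye : z j ^ e ≠ 0 := pow_ne_zero _ hy0
      have hden : ∀ p q A B : ℂ, p * (z j ^ e * A) + q * (z j ^ (e + 1) * B) =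
          z j ^ e * (p * A + q * (z j * B)) := fun p q A B => by ring
      have hnum : ∀ s r A B : ℂ, ((0 : ℝ) : ℂ) * s + r * (z j ^ e * B) = z j ^ e * (r * B) :=
        fun s r A B => by push_cast; ring
      rw [hden, hnum _ _ 0, mul_div_mul_left _ _ hye]
      exact ⟨mul_ne_zero hye h1, h2⟩
    · obtain ⟨l, hl, -⟩ := exists_ne_zero_of_sum_ne_zero hz0
      simp only [mem_filter, mem_range] at hl
      have hle := share_mono_left M hU l
      have hz1 : ∑ l ∈ range M with share M U l = U / M + 1 ∧ share M U' l = U' / M, lam l = 0 := by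
        refine sum_eq_zero fun i hi => ?_
        simp only [mem_filter, mem_range] at hi
        exfalso
        rcases le_total i l with h | h
        · have := share_mono_right M U h
          omega
        · have := share_mono_right M U' h
          omega
      rw [hz1]
      obtain ⟨e', rfl⟩ : ∃ e', e = e' + 1 := ⟨e - 1, by omega⟩
      have e1 : U / M - U' / M = e' + 1 := by omega
      have e2 : U / M - (U' / M + 1) = e' := by omega
      have e3 : U / M + 1 - (U' / M + 1) = e' + 1 := by omega
      rw [e1, e2, e3]
      obtain ⟨h1, h2⟩ := im_div_step_of_right hA hB (hz j) hp (hnn (U / M) (U' / M + 1))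
        (hnn (U / M + 1) (U' / M + 1))
      have hye : z j ^ e' ≠ 0 := pow_ne_zero _ hy0
      have hden : ∀ s p A : ℂ, p * (z j ^ (e' + 1) * A) + ((0 : ℝ) : ℂ) * s =
          z j ^ e' * (p * (z j * A)) := fun s p A => by push_cast; ring
      have hnum : ∀ q r A B : ℂ, q * (z j ^ e' * A) + r * (z j ^ (e' + 1) * B) =
          z j ^ e' * (q * A + r * (z j * B)) := fun q r A B => by ring
      rw [hden, hnum, mul_div_mul_left _ _ hye]
      exact ⟨mul_ne_zero hye h1, h2⟩
  have hmap : ∀ V : ℕ, ∀ l ∈ range M, share M V l ∈ (range M).image (share M V) :=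
    fun V l hl => mem_image_of_mem _ hl
  refine ⟨fun v => ?_, fun v hv => ?_, fun l hl => ?_, fun z hz => (stable z hz).1,
    fun z hz => (stable z hz).2, ?_, fun y x hy hx => ?_⟩
  · exact NonnegCoeff.sum fun l _ =>
      (nonnegCoeff_C (hlam l).le).mul ((hf.nonneg _).mul (nonnegCoeff_X_pow j _))
  · rw [stepPoly]
    refine sum_eq_zero fun l hl => ?_
    rw [mem_filter] at hl
    exact absurd (hl.2 ▸ hmap U' l hl.1) hv
  · obtain ⟨d, hd, -⟩ := hf.hom l hl
    have hle := share_mono_left M hU l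
    refine ⟨N - rest - share M U' l, by omega, IsHomogeneous.sum _ _ _ fun i hi => ?_⟩
    simp only [mem_filter, mem_range] at hi
    obtain ⟨d', hd', hh⟩ := hf.hom i hi.1
    have hle' := share_mono_left M hU i
    have key := (isHomogeneous_C (Fin n) (lam i)).mul (hh.mul ((isHomogeneous_X ℝ j).pow
      (share M U i - share M U' i)))
    convert key using 1
    omega
  · exact mul_pos hf.pos (prod_pos fun l hl =>
      mul_pos (by exact_mod_cast mult_pos U (mem_range.1 hl)) (hlam l))
  · set t : ℕ → ℝ := fun l => lam l * (y j ^ (share M U l - share M U' l) * x (share M U' l))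
      with ht
    have htpos : ∀ l < M, 0 < t l := fun l hl =>
      mul_pos (hlam l) (mul_pos (pow_pos (hy j) _) (hx l hl))
    have hcap := hf.cap y (fun v => ∑ l ∈ range M with share M U l = v, t l) hy fun l hl =>
      sum_pos (fun i hi => htpos i (mem_range.1 (mem_filter.1 hi).1)) ⟨l, by simp [hl]⟩
    have e1 : ∑ v ∈ (range M).image (share M U), eval y (f v) *
        ∑ l ∈ range M with share M U l = v, t l =
        ∑ l ∈ range M, eval y (f (share M U l)) * t l := by
      rw [← sum_fiberwise_of_maps_to (hmap U)]
      refine sum_congr rfl fun v _ => ?_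
      rw [mul_sum]
      exact sum_congr rfl fun l hl => by rw [(mem_filter.1 hl).2]
    have e2 : ∑ v ∈ (range M).image (share M U'), eval y (stepPoly M U U' lam j f v) * x v =
        ∑ l ∈ range M, eval y (f (share M U l)) * t l := by
      rw [← sum_fiberwise_of_maps_to (hmap U')]
      refine sum_congr rfl fun v _ => ?_
      rw [stepPoly, map_sum, sum_mul]
      refine sum_congr rfl fun l hl => ?_
      rw [← (mem_filter.1 hl).2, ht]
      simp only [map_mul, eval_C, map_pow, eval_X]
      ring
    rw [e2, ← e1]
    refine le_trans ?_ hcap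
    have h1 := prod_card_fiber_mul_le (s := range M) (share M U) t fun l hl =>
      (htpos l (mem_range.1 hl)).le
    have e3 : ∏ l ∈ range M, ((#{l' ∈ range M | share M U l' = share M U l} : ℝ) * t l) =
        (∏ l ∈ range M, ((mult M U l : ℝ) * lam l)) * y j ^ (U - U') *
          ∏ l ∈ range M, x (share M U' l) := by
      rw [← sum_share_sub hM hU, ← prod_pow_eq_pow_sum, ← prod_mul_distrib, ← prod_mul_distrib]
      exact prod_congr rfl fun l _ => by rw [ht, mult]; ring
    have e4 : ∏ i, y i ^ (G + Finsupp.single j (U - U')) i =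
        (∏ i, y i ^ G i) * y j ^ (U - U') := by
      simp only [Finsupp.add_apply, pow_add, prod_mul_distrib]
      congr 1
      rw [prod_eq_single j]
      · simp
      · intro b _ hb
        simp [hb.symm]
      · simp
    have hy' : 0 ≤ γ * ∏ i, y i ^ G i :=
      mul_nonneg hf.pos.le (prod_nonneg fun i _ => (pow_pos (hy i) _).le)
    calc _ = γ * (∏ i, y i ^ G i) *
          ∏ l ∈ range M, ((#{l' ∈ range M | share M U l' = share M U l} : ℝ) * t l) := by
            rw [e3, e4]; ring
      _ ≤ _ := mul_le_mul_of_nonneg_left h1 hy'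

/-- The coefficient inequality obtained by filling the remaining columns `J` of the current row,
for all distributions of the remaining amounts. -/
def RowBound {M : ℕ} (N rest : ℕ) (κ : ℝ) (c : Fin n →₀ ℕ) (ck : Fin M → Fin n →₀ ℕ)
    (Q₀ : MvPolynomial (Fin n) ℝ) (Q : Fin M → MvPolynomial (Fin n) ℝ) (w : Fin n → ℝ)
    (J : List (Fin n)) : Prop :=
  ∀ (r : Fin M → ℕ) (f : ℕ → MvPolynomial (Fin n) ℝ) (g : Fin M → Fin n →₀ ℕ) (γ : ℝ),
    Admissible M (∑ k, r k) rest N f (∑ k, g k) γ →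
    κ * γ * ∏ k, coeff (ck k) (monomial (g k) 1 * (rowPoly w J (r k) * Q k)) ≤
      (∑ v ∈ (range M).image (share M (∑ k, r k)), coeff c (f v * (rowPoly w J v * Q₀))) ^ M

lemma le_card_pow_mul_prod {s : Finset ℕ} {K : ℝ} {a : ℕ → ℝ} (ha : ∀ l ∈ s, 0 ≤ a l)
    (h : ∀ lam : ℕ → ℝ, (∀ l, 0 < lam l) →
      K * ∏ l ∈ s, lam l ≤ (∑ l ∈ s, lam l * a l) ^ #s) :
    K ≤ (#s : ℝ) ^ #s * ∏ l ∈ s, a l := by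
  have key : ∀ ε : ℝ, 0 < ε → K ≤ (#s : ℝ) ^ #s * ∏ l ∈ s, (a l + ε) := by
    intro ε hε
    have hpos : ∀ l ∈ s, 0 < a l + ε := fun l hl => by linarith [ha l hl]
    have h1 := h (fun l => if l ∈ s then (a l + ε)⁻¹ else 1) fun l => by
      split_ifs with hl
      exacts [inv_pos.2 (hpos l hl), one_pos]
    rw [prod_congr rfl fun l hl => if_pos hl, prod_inv_distrib,
      sum_congr rfl (g := fun l => (a l + ε)⁻¹ * a l) fun l hl => by rw [if_pos hl],
      ← div_eq_mul_inv, div_le_iff₀ (prod_pos hpos)] at h1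
    refine h1.trans (mul_le_mul_of_nonneg_right ?_ (prod_pos hpos).le)
    refine pow_le_pow_left₀ (sum_nonneg fun l hl =>
      mul_nonneg (inv_pos.2 (hpos l hl)).le (ha l hl)) ?_ _
    calc ∑ l ∈ s, (a l + ε)⁻¹ * a l ≤ ∑ l ∈ s, (1 : ℝ) := sum_le_sum fun l hl => by
          rw [inv_mul_le_iff₀ (hpos l hl)]; linarith
      _ = #s := by simp
  have hc : Continuous fun ε : ℝ => (#s : ℝ) ^ #s * ∏ l ∈ s, (a l + ε) := by fun_prop
  have ht := (hc.tendsto 0).mono_left (nhdsWithin_le_nhds (s := Set.Ioi 0))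
  simp only [add_zero] at ht
  exact ge_of_tendsto ht (Filter.eventually_of_mem self_mem_nhdsWithin key)

lemma sum_image_eq_sum_div_mult (M U : ℕ) (Ψ : ℕ → ℝ) :
    ∑ v ∈ (range M).image (share M U), Ψ v =
      ∑ l ∈ range M, Ψ (share M U l) / mult M U l := by
  rw [← sum_fiberwise_of_maps_to fun l (hl : l ∈ range M) => mem_image_of_mem (share M U) hl]
  refine sum_congr rfl fun v hv => ?_
  have h : ∀ l ∈ ({l ∈ range M | share M U l = v} : Finset ℕ),
      Ψ (share M U l) / mult M U l = Ψ v / #{l' ∈ range M | share M U l' = v} := fun l hl => by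
    rw [mult, (mem_filter.1 hl).2]
  rw [sum_congr rfl h, sum_const, nsmul_eq_mul]
  obtain ⟨l, hl, rfl⟩ := mem_image.1 hv
  have : (#{l' ∈ range M | share M U l' = share M U l} : ℝ) ≠ 0 := by
    exact_mod_cast (mult_pos U (mem_range.1 hl)).ne'
  rw [mul_div_cancel₀ _ this]

lemma prod_mult_pos (M U : ℕ) : 0 < ∏ l ∈ range M, (mult M U l : ℝ) :=
  prod_pos fun l hl => by exact_mod_cast mult_pos U (mem_range.1 hl)

lemma RowBound.step {M N rest : ℕ} (hM : 0 < M) {κ : ℝ} {c : Fin n →₀ ℕ}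
    {ck : Fin M → Fin n →₀ ℕ} {Q₀ : MvPolynomial (Fin n) ℝ} {Q : Fin M → MvPolynomial (Fin n) ℝ}
    {w : Fin n → ℝ} (hw : ∀ j, 0 ≤ w j) (hQ₀ : NonnegCoeff Q₀) {J : List (Fin n)}
    (h : RowBound N rest κ c ck Q₀ Q w J) (j : Fin n) {r r' : Fin M → ℕ} (hr : ∀ k, r' k ≤ r k)
    {f : ℕ → MvPolynomial (Fin n) ℝ} {g : Fin M → Fin n →₀ ℕ} {γ : ℝ}
    (hf : Admissible M (∑ k, r k) rest N f (∑ k, g k) γ) :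
    κ * γ * (∏ l ∈ range M, (mult M (∑ k, r k) l : ℝ)) * ∏ k, coeff (ck k)
        (monomial (g k) 1 * X j ^ (r k - r' k) * (rowPoly w J (r' k) * Q k)) ≤
      (M : ℝ) ^ M * ∏ l ∈ range M, coeff c (f (share M (∑ k, r k) l) *
        X j ^ (share M (∑ k, r k) l - share M (∑ k, r' k) l) *
          (rowPoly w J (share M (∑ k, r' k) l) * Q₀)) := by
  have hU : ∑ k, r' k ≤ ∑ k, r k := sum_le_sum fun k _ => hr k
  set U := ∑ k, r k
  set U' := ∑ k, r' k
  have hL := le_card_pow_mul_prod (s := range M)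
    (K := κ * γ * (∏ l ∈ range M, (mult M U l : ℝ)) * ∏ k, coeff (ck k)
        (monomial (g k) 1 * X j ^ (r k - r' k) * (rowPoly w J (r' k) * Q k)))
    (a := fun l => coeff c (f (share M U l) * X j ^ (share M U l - share M U' l) *
          (rowPoly w J (share M U' l) * Q₀)))
    (fun l _ => ((hf.nonneg _).mul (nonnegCoeff_X_pow j _)).mul
      ((nonnegCoeff_rowPoly hw J _).mul hQ₀) c) fun lam hlam => ?_
  · simpa only [card_range] using hL
  · have hstep := hf.step hM hU j hlam
    have hg : ∑ k, g k + Finsupp.single j (U - U') =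
        ∑ k, (g k + Finsupp.single j (r k - r' k)) := by
      rw [sum_add_distrib, ← Finsupp.single_finsetSum, sum_tsub_distrib _ fun k _ => hr k]
    rw [hg] at hstep
    have h1 := h r' _ _ _ hstep
    have e1 : ∑ v ∈ (range M).image (share M U'),
        coeff c (stepPoly M U U' lam j f v * (rowPoly w J v * Q₀)) =
        ∑ l ∈ range M, lam l * coeff c (f (share M U l) *
          X j ^ (share M U l - share M U' l) * (rowPoly w J (share M U' l) * Q₀)) := by
      rw [← sum_fiberwise_of_maps_to fun l (hl : l ∈ range M) => mem_image_of_mem (share M U') hl]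
      refine sum_congr rfl fun v _ => ?_
      rw [stepPoly, sum_mul, coeff_sum]
      refine sum_congr rfl fun l hl => ?_
      rw [(mem_filter.1 hl).2, mul_assoc, coeff_C_mul]
    have e2 : ∀ k, (monomial (g k + Finsupp.single j (r k - r' k)) (1 : ℝ) :
        MvPolynomial (Fin n) ℝ) = monomial (g k) 1 * X j ^ (r k - r' k) := fun k => by
      rw [X_pow_eq_monomial, monomial_mul, one_mul]
    rw [e1] at h1
    simp only [e2] at h1
    rw [card_range]
    refine le_trans (le_of_eq ?_) h1
    rw [prod_mul_distrib]
    ring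

lemma RowBound.cons {M N rest : ℕ} (hM : 0 < M) {κ : ℝ} (hκ : 0 < κ) {c : Fin n →₀ ℕ}
    {ck : Fin M → Fin n →₀ ℕ} {Q₀ : MvPolynomial (Fin n) ℝ} {Q : Fin M → MvPolynomial (Fin n) ℝ}
    {w : Fin n → ℝ} (hw : ∀ j, 0 ≤ w j) (hQ₀ : NonnegCoeff Q₀) (hQ : ∀ k, NonnegCoeff (Q k))
    {J : List (Fin n)} (h : RowBound N rest κ c ck Q₀ Q w J) (j : Fin n) :
    RowBound N rest κ c ck Q₀ Q w (j :: J) := by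
  intro r f g γ hf
  have hstep := fun r' hr => h.step hM hw hQ₀ j (r' := r') hr hf
  set U := ∑ k, r k
  set D := ∏ l ∈ range M, (mult M U l : ℝ)
  have hD : 0 < D := prod_mult_pos M U
  have hB1 : ∀ k, r k < U + 2 := fun k =>
    (single_le_sum (f := r) (fun _ _ => Nat.zero_le _) (mem_univ k)).trans_lt (by omega)
  have hB2 : ∀ l < M, share M U l < U + 2 := fun l hl => by
    have := Nat.div_le_self U M
    rcases share_mem hM U hl with h | h <;> omega
  have hV : ∀ k v, 0 ≤ coeff (ck k)
      (monomial (g k) 1 * X j ^ (r k - v) * (rowPoly w J v * Q k)) := fun k v =>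
    ((nonnegCoeff_monomial _ zero_le_one).mul (nonnegCoeff_X_pow j _)).mul
      ((nonnegCoeff_rowPoly hw J _).mul (hQ k)) _
  have hL : ∀ l v, 0 ≤ coeff c (f (share M U l) * X j ^ (share M U l - v) *
      (rowPoly w J v * Q₀)) := fun l v =>
    ((hf.nonneg _).mul (nonnegCoeff_X_pow j _)).mul ((nonnegCoeff_rowPoly hw J _).mul hQ₀) _
  have hγ := hf.pos
  have hκγD : 0 < κ * γ * D := mul_pos (mul_pos hκ hγ) hD
  have hPL := discrete_prekopa_leindler hM (U + 2)
    (fun k v => if v ≤ r k then w j ^ (r k - v) * coeff (ck k)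
      (monomial (g k) 1 * X j ^ (r k - v) * (rowPoly w J v * Q k)) else 0)
    (fun k v => by
      split_ifs
      exacts [mul_nonneg (pow_nonneg (hw j) _) (hV k v), le_rfl])
    (fun l v => if v ≤ share M U l then w j ^ (share M U l - v) * coeff c
      (f (share M U l) * X j ^ (share M U l - v) * (rowPoly w J v * Q₀)) else 0)
    (fun l v => by
      split_ifs
      exacts [mul_nonneg (pow_nonneg (hw j) _) (hL l v), le_rfl])
    ((M : ℝ) ^ M / (κ * γ * D)) (by positivity) fun s _ => ?_
  · have e1 : ∀ k, (∑ v ∈ range (U + 2), if v ≤ r k then w j ^ (r k - v) * coeff (ck k)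
        (monomial (g k) 1 * X j ^ (r k - v) * (rowPoly w J v * Q k)) else 0) =
        coeff (ck k) (monomial (g k) 1 * (rowPoly w (j :: J) (r k) * Q k)) := fun k =>
      (coeff_mul_rowPoly_cons w j J (ck k) _ _ (hB1 k)).symm
    have e2 : ∀ l ∈ range M, (∑ v ∈ range (U + 2), if v ≤ share M U l then
        w j ^ (share M U l - v) * coeff c
          (f (share M U l) * X j ^ (share M U l - v) * (rowPoly w J v * Q₀)) else 0) =
        coeff c (f (share M U l) * (rowPoly w (j :: J) (share M U l) * Q₀)) := fun l hl =>
      (coeff_mul_rowPoly_cons w j J c _ _ (hB2 l (mem_range.1 hl))).symm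
    rw [prod_congr rfl fun k _ => e1 k, prod_congr rfl e2, div_mul_eq_mul_div,
      le_div_iff₀ hκγD] at hPL
    rw [sum_image_eq_sum_div_mult M U fun v => coeff c (f v * (rowPoly w (j :: J) v * Q₀))]
    have hΨ : ∀ l ∈ range M, 0 ≤ coeff c (f (share M U l) *
        (rowPoly w (j :: J) (share M U l) * Q₀)) / mult M U l := fun l _ =>
      div_nonneg ((hf.nonneg _).mul ((nonnegCoeff_rowPoly hw _ _).mul hQ₀) _) (Nat.cast_nonneg _)
    have hamgm := prod_le_sum_div_card_pow (range M) _ hΨ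
    have hM' : (0 : ℝ) < (M : ℝ) ^ M := pow_pos (by exact_mod_cast hM) _
    rw [prod_div_distrib, card_range, div_pow, div_le_div_iff₀ hD hM'] at hamgm
    refine le_of_mul_le_mul_right ?_ hD
    calc _ = _ := by ring
      _ ≤ _ := hPL
      _ = _ := by ring
      _ ≤ _ := hamgm
  · by_cases hs : ∀ k, s k ≤ r k
    · have hU : ∑ k, s k ≤ U := sum_le_sum fun k _ => hs k
      have h1 := hstep s hs
      have hsh : ∀ l, (∑ k, s k + l) / M ≤ share M U l := share_mono_left M hU
      simp only [hs, hsh, if_true, prod_mul_distrib]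
      have e1 : ∏ k, w j ^ (r k - s k) = w j ^ (U - ∑ k, s k) := by
        rw [prod_pow_eq_pow_sum, sum_tsub_distrib _ fun k _ => hs k]
      have e2 : ∏ l ∈ range M, w j ^ (share M U l - (∑ k, s k + l) / M) =
          w j ^ (U - ∑ k, s k) := by
        rw [prod_pow_eq_pow_sum]
        exact congrArg _ (sum_share_sub hM hU)
      rw [e1, e2, div_mul_eq_mul_div, le_div_iff₀ hκγD]
      have h2 := mul_le_mul_of_nonneg_left h1 (pow_nonneg (hw j) (U - ∑ k, s k))
      unfold share at h2 ⊢
      linarith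
    · push Not at hs
      obtain ⟨k, hk⟩ := hs
      rw [prod_eq_zero (mem_univ k) (by rw [if_neg (by omega)])]
      refine mul_nonneg (by positivity) (prod_nonneg fun l _ => ?_)
      split_ifs
      exacts [mul_nonneg (pow_nonneg (hw j) _) (hL l _), le_rfl]

/-- The coefficient inequality obtained by filling all remaining rows, for all stable
polynomials and monomials recording the rows filled so far. -/
def StartBound {M : ℕ} (N rest : ℕ) (κ : ℝ) (c : Fin n →₀ ℕ) (ck : Fin M → Fin n →₀ ℕ)
    (Q₀ : MvPolynomial (Fin n) ℝ) (Q : Fin M → MvPolynomial (Fin n) ℝ) : Prop :=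
  ∀ (A : MvPolynomial (Fin n) ℝ) (g : Fin M → Fin n →₀ ℕ) (γ : ℝ),
    NonnegCoeff A → 0 < γ → (∃ d, d + rest = N ∧ A.IsHomogeneous d) → IsStable A →
    (∀ y : Fin n → ℝ, (∀ j, 0 < y j) → γ * ∏ j, y j ^ (∑ k, g k) j ≤ eval y A ^ M) →
    κ * γ * ∏ k, coeff (ck k) (monomial (g k) 1 * Q k) ≤ coeff c (A * Q₀) ^ M

lemma StartBound.rowBound_nil {M N rest : ℕ} (hM : 0 < M) {κ : ℝ} {c : Fin n →₀ ℕ}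
    {ck : Fin M → Fin n →₀ ℕ} {Q₀ : MvPolynomial (Fin n) ℝ} {Q : Fin M → MvPolynomial (Fin n) ℝ}
    (hQ₀ : NonnegCoeff Q₀) (h : StartBound N rest κ c ck Q₀ Q) (w : Fin n → ℝ) :
    RowBound N rest κ c ck Q₀ Q w [] := by
  intro r f g γ hf
  by_cases hr : ∀ k, r k = 0
  · have hU : ∑ k, r k = 0 := sum_eq_zero fun k _ => hr k
    rw [hU] at hf ⊢
    have hsh : ∀ l ∈ range M, share M 0 l = 0 := fun l hl => by
      rw [share, zero_add]
      exact Nat.div_eq_of_lt (mem_range.1 hl)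
    have him : (range M).image (share M 0) = {0} := by
      rw [image_congr fun l hl => hsh l hl]
      exact image_const (nonempty_range_iff.2 hM.ne') 0
    rw [him, sum_singleton]
    simp only [hr, rowPoly, if_true, one_mul]
    refine h (f 0) g γ (hf.nonneg 0) hf.pos ?_ ?_ fun y hy => ?_
    · obtain ⟨d, hd, hh⟩ := hf.hom 0 hM
      rw [hsh 0 (mem_range.2 hM)] at hd hh
      exact ⟨d, by omega, hh⟩
    · intro z hz
      simpa using hf.ne_zero z hz
    · simpa [him] using hf.cap y (fun _ => 1) hy fun _ _ => one_pos
  · push Not at hr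
    obtain ⟨k, hk⟩ := hr
    rw [prod_eq_zero (mem_univ k) (by simp [rowPoly, hk]), mul_zero]
    refine pow_nonneg (sum_nonneg fun v _ => (hf.nonneg v).mul (NonnegCoeff.mul ?_ hQ₀) _) _
    rw [rowPoly]
    split_ifs
    exacts [nonnegCoeff_one, nonnegCoeff_zero]

lemma RowBound.startBound {M N rest : ℕ} (hM : 0 < M) {κ : ℝ} {c : Fin n →₀ ℕ}
    {ck : Fin M → Fin n →₀ ℕ} {Q₀ : MvPolynomial (Fin n) ℝ} {Q : Fin M → MvPolynomial (Fin n) ℝ}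
    {w : Fin n → ℝ} {J : List (Fin n)} (h : RowBound N rest κ c ck Q₀ Q w J)
    {R : ℕ} {r : Fin M → ℕ} (hr : ∑ k, r k = M * R) :
    StartBound N (R + rest) κ c ck (rowPoly w J R * Q₀) (fun k => rowPoly w J (r k) * Q k) := by
  intro A g γ hA hγ ⟨d, hd, hhom⟩ hst hcap
  have hsh : ∀ l ∈ range M, share M (M * R) l = R := fun l hl => by
    rw [share, Nat.mul_add_div hM, Nat.div_eq_of_lt (mem_range.1 hl), add_zero]
  have him : (range M).image (share M (M * R)) = {R} := by
    rw [image_congr fun l hl => hsh l hl]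
    exact image_const (nonempty_range_iff.2 hM.ne') R
  have hdiv : M * R / M = R := Nat.mul_div_cancel_left _ hM
  have key := h r (fun v => if v = R then A else 0) g γ ?_
  · rw [hr, him, sum_singleton, if_pos rfl] at key
    exact key
  rw [hr]
  refine ⟨fun v => ?_, fun v hv => ?_, fun l hl => ?_, fun z hz => ?_, fun z hz => ?_, hγ,
    fun y x hy hx => ?_⟩
  · split_ifs
    exacts [hA, nonnegCoeff_zero]
  · rw [him, mem_singleton] at hv
    rw [if_neg hv]
  · rw [hsh l (mem_range.2 hl), if_pos rfl]
    exact ⟨d, by omega, hhom⟩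
  · rw [hdiv, if_pos rfl]
    exact hst z hz
  · rw [hdiv, if_neg (by omega)]
    simp
  · have hxR : 0 < x R := by
      have := hx 0 hM
      rwa [hsh 0 (mem_range.2 hM)] at this
    have hprod : ∏ l ∈ range M, x (share M (M * R) l) = x R ^ M := by
      rw [prod_congr rfl fun l hl => congrArg x (hsh l hl), prod_const, card_range]
    rw [him, sum_singleton, if_pos rfl, hprod, mul_pow]
    exact mul_le_mul_of_nonneg_right (hcap y hy) (pow_pos hxR _).le

lemma RowBound.of_nil {M N rest : ℕ} (hM : 0 < M) {κ : ℝ} (hκ : 0 < κ) {c : Fin n →₀ ℕ}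
    {ck : Fin M → Fin n →₀ ℕ} {Q₀ : MvPolynomial (Fin n) ℝ} {Q : Fin M → MvPolynomial (Fin n) ℝ}
    {w : Fin n → ℝ} (hw : ∀ j, 0 ≤ w j) (hQ₀ : NonnegCoeff Q₀) (hQ : ∀ k, NonnegCoeff (Q k))
    (h : RowBound N rest κ c ck Q₀ Q w []) (J : List (Fin n)) :
    RowBound N rest κ c ck Q₀ Q w J := by
  induction J with
  | nil => exact h
  | cons j J ih => exact ih.cons hM hκ hw hQ₀ hQ j

/-- The constant `(N! / N ^ N) ∏ c_j ^ c_j / c_j!`. -/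
noncomputable def capConst (N : ℕ) (c : Fin n → ℕ) : ℝ :=
  (N.factorial / (N : ℝ) ^ N) * ∏ j, ((c j : ℝ) ^ c j / ((c j).factorial : ℝ))

lemma natCast_pow_self_pos (a : ℕ) : (0 : ℝ) < (a : ℝ) ^ a := by
  rcases Nat.eq_zero_or_pos a with rfl | h
  · simp
  · positivity

lemma capConst_pos (N : ℕ) (c : Fin n → ℕ) : 0 < capConst N c :=
  mul_pos (div_pos (by positivity) (natCast_pow_self_pos N))
    (prod_pos fun j _ => div_pos (natCast_pow_self_pos _) (by positivity))

lemma startBound_one {M N : ℕ} (hM : 0 < M) {c : Fin n →₀ ℕ} {ck : Fin M → Fin n →₀ ℕ}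
    (hc : ∑ j, c j = N) (hck : ∑ k, ck k = M • c) :
    StartBound N 0 (capConst N c ^ M) c ck 1 (fun _ => 1) := by
  intro A g γ hA hγ ⟨d, hd, hhom⟩ hst hcap
  obtain rfl : d = N := by omega
  simp only [mul_one]
  by_cases hg : ∀ k, g k = ck k
  · have hgs : ∑ k, g k = M • c := by rw [← hck]; exact sum_congr rfl fun k _ => hg k
    have hM' : M ≠ 0 := hM.ne'
    have hδ : (γ ^ (M : ℝ)⁻¹) ^ M = γ := Real.rpow_inv_natCast_pow hγ.le hM'
    have hδ0 : 0 ≤ γ ^ (M : ℝ)⁻¹ := Real.rpow_nonneg hγ.le _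
    have hcap' : ∀ y : Fin n → ℝ, (∀ j, 0 < y j) →
        γ ^ (M : ℝ)⁻¹ * ∏ j, y j ^ c j ≤ eval y A := by
      intro y hy
      refine le_of_pow_le_pow_left₀ hM' (eval_nonneg_of_nonnegCoeff hA hy) ?_
      rw [mul_pow, hδ, ← prod_pow]
      have := hcap y hy
      rw [hgs] at this
      refine le_trans (le_of_eq ?_) this
      congr 1
      exact prod_congr rfl fun j _ => by
        rw [Finsupp.smul_apply, smul_eq_mul, ← pow_mul, mul_comm]
    have hG := gurvits_coeff_bound hhom hst hA c hc hδ0 hcap'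
    have h2 := pow_le_pow_left₀ (mul_nonneg hδ0 (capConst_pos d c).le) hG M
    rw [mul_pow, hδ] at h2
    simp only [hg, coeff_monomial, if_true, prod_const_one, mul_one]
    rw [mul_comm]
    exact h2
  · push Not at hg
    obtain ⟨k, hk⟩ := hg
    rw [prod_eq_zero (mem_univ k) (by rw [coeff_monomial, if_neg hk]), mul_zero]
    exact pow_nonneg (hA _) _

/-- The generating polynomial in the columns of all tables with given row sums. -/
noncomputable def rowsPoly {m : ℕ} (W : Fin m → Fin n → ℝ) (I : List (Fin m)) (R : Fin m → ℕ) :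
    MvPolynomial (Fin n) ℝ :=
  (I.map fun i => rowPoly (W i) (List.finRange n) (R i)).prod

lemma nonnegCoeff_rowsPoly {m : ℕ} {W : Fin m → Fin n → ℝ} (hW : ∀ i j, 0 ≤ W i j)
    (I : List (Fin m)) (R : Fin m → ℕ) : NonnegCoeff (rowsPoly W I R) := by
  induction I with
  | nil => exact nonnegCoeff_one
  | cons i I ih =>
    rw [rowsPoly, List.map_cons, List.prod_cons]
    exact (nonnegCoeff_rowPoly (hW i) _ _).mul ih

lemma startBound_rowsPoly {M N m : ℕ} (hM : 0 < M) {c : Fin n →₀ ℕ} {ck : Fin M → Fin n →₀ ℕ}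
    (hc : ∑ j, c j = N) (hck : ∑ k, ck k = M • c) {W : Fin m → Fin n → ℝ}
    (hW : ∀ i j, 0 ≤ W i j) {R : Fin m → ℕ} {r : Fin M → Fin m → ℕ}
    (hr : ∀ i, ∑ k, r k i = M * R i) (I : List (Fin m)) :
    StartBound N (I.map R).sum (capConst N c ^ M) c ck (rowsPoly W I R)
      (fun k => rowsPoly W I (r k)) := by
  induction I with
  | nil => exact startBound_one hM hc hck
  | cons i I ih =>
    have hκ : 0 < capConst N c ^ M := pow_pos (capConst_pos N c) M
    exact ((ih.rowBound_nil hM (nonnegCoeff_rowsPoly hW I R) (W i)).of_nil hM hκ (hW i)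
      (nonnegCoeff_rowsPoly hW I R) (fun k => nonnegCoeff_rowsPoly hW I (r k))
      (List.finRange n)).startBound hM (hr i)

lemma prod_coeff_rowsPoly_le {M N m : ℕ} (hM : 0 < M) {c : Fin n →₀ ℕ}
    {ck : Fin M → Fin n →₀ ℕ} (hc : ∑ j, c j = N) (hck : ∑ k, ck k = M • c)
    {W : Fin m → Fin n → ℝ} (hW : ∀ i j, 0 ≤ W i j) {R : Fin m → ℕ} {r : Fin M → Fin m → ℕ}
    (hR : ∑ i, R i = N) (hr : ∀ i, ∑ k, r k i = M * R i) :
    capConst N c ^ M * ∏ k, coeff (ck k) (rowsPoly W (List.finRange m) (r k)) ≤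
      coeff c (rowsPoly W (List.finRange m) R) ^ M := by
  have hsum : ((List.finRange m).map R).sum = N := by
    rw [← hR, ← List.ofFn_eq_map, List.sum_ofFn]
  have h := startBound_rowsPoly hM hc hck hW hr (List.finRange m) 1 0 1 nonnegCoeff_one one_pos
    ⟨0, by rw [hsum, zero_add], isHomogeneous_one _ _⟩ (fun z _ => by simp) (fun y _ => by simp)
  simpa using h

lemma rowPoly_eq_coeff_prod (w : Fin n → ℝ) (J : List (Fin n)) (ρ : ℕ) :
    rowPoly w J ρ = PowerSeries.coeff ρ (J.map fun j =>
      (PowerSeries.mk fun e => C (w j ^ e) * X j ^ e : PowerSeries (MvPolynomial (Fin n) ℝ))).prod := by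
  induction J generalizing ρ with
  | nil => simp [rowPoly, PowerSeries.coeff_one]
  | cons j J ih =>
    rw [rowPoly, List.map_cons, List.prod_cons, mul_comm, PowerSeries.coeff_mul,
      Finset.Nat.sum_antidiagonal_eq_sum_range_succ_mk]
    refine sum_congr rfl fun v _ => ?_
    rw [ih, PowerSeries.coeff_mk, mul_comm]

lemma rowPoly_finRange_eq_sum (w : Fin n → ℝ) (ρ : ℕ) :
    rowPoly w (List.finRange n) ρ =
      ∑ d ∈ finsuppAntidiag univ ρ, monomial d (∏ j, w j ^ d j) := by
  rw [rowPoly_eq_coeff_prod, ← List.ofFn_eq_map, List.prod_ofFn, PowerSeries.coeff_prod]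
  refine sum_congr rfl fun d _ => ?_
  simp only [PowerSeries.coeff_mk]
  rw [prod_mul_distrib, monomial_eq, Finsupp.prod_fintype _ _ fun i => pow_zero _, map_prod]

lemma coeff_rowsPoly_eq_tableWeight {m : ℕ} (W : Fin m → Fin n → ℝ) (R : Fin m → ℕ)
    (c : Fin n →₀ ℕ) :
    coeff c (rowsPoly W (List.finRange m) R) = tableWeight R c W := by
  classical
  set S : Finset (Fin m → Fin n →₀ ℕ) :=
    {D ∈ Fintype.piFinset fun i => finsuppAntidiag univ (R i) | ∑ i, D i = c} with hS
  have h1 : coeff c (rowsPoly W (List.finRange m) R) = ∑ D ∈ S, ∏ i, ∏ j, W i j ^ D i j := by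
    rw [rowsPoly, ← List.ofFn_eq_map, List.prod_ofFn]
    simp only [rowPoly_finRange_eq_sum]
    rw [prod_univ_sum, coeff_sum, hS, sum_filter]
    refine sum_congr rfl fun D _ => ?_
    rw [← monomial_sum_prod, coeff_monomial]
  have hinj : Set.InjOn (fun (D : Fin m → Fin n →₀ ℕ) i j => D i j) S := fun D _ D' _ h => by
    funext i
    ext j
    exact congrFun (congrFun h i) j
  have hset : {D : Fin m → Fin n → ℕ | (∀ i, ∑ j, D i j = R i) ∧ ∀ j, ∑ i, D i j = c j} =
      (S.image fun (D : Fin m → Fin n →₀ ℕ) i j => D i j : Set (Fin m → Fin n → ℕ)) := by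
    ext D
    simp only [Set.mem_ofPred_eq, coe_image, Set.mem_image, mem_coe]
    constructor
    · rintro ⟨hr, hc⟩
      refine ⟨fun i => Finsupp.equivFunOnFinite.symm (D i), ?_, rfl⟩
      rw [hS, mem_filter, Fintype.mem_piFinset]
      refine ⟨fun i => ?_, ?_⟩
      · rw [mem_finsuppAntidiag]
        exact ⟨hr i, subset_univ _⟩
      · ext j
        rw [Finsupp.finsetSum_apply]
        exact hc j
    · rintro ⟨D', hD', rfl⟩
      rw [hS, mem_filter, Fintype.mem_piFinset] at hD'
      refine ⟨fun i => ?_, fun j => ?_⟩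
      · exact (mem_finsuppAntidiag.1 (hD'.1 i)).1
      · rw [← hD'.2, Finsupp.finsetSum_apply]
  have h2 : tableWeight R c W = ∑' D : {D : Fin m → Fin n → ℕ | (∀ i, ∑ j, D i j = R i) ∧
      ∀ j, ∑ i, D i j = c j}, ∏ i, ∏ j, W i j ^ (D : Fin m → Fin n → ℕ) i j := rfl
  rw [h1, h2, hset, Finset.tsum_subtype' _ fun D : Fin m → Fin n → ℕ =>
    ∏ i, ∏ j, W i j ^ D i j, sum_image hinj]

lemma tableWeight_transpose {m : ℕ} (R : Fin m → ℕ) (c : Fin n → ℕ) (W : Fin m → Fin n → ℝ) :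
    tableWeight c R (fun j i => W i j) = tableWeight R c W := by
  refine (Equiv.tsum_eq ((Equiv.piComm fun (_ : Fin m) (_ : Fin n) => ℕ).subtypeEquiv
    fun D => ?_) _).symm.trans (tsum_congr fun D => ?_)
  · exact and_comm
  · exact prod_comm

lemma prod_tableWeight_le_pow {M N m : ℕ} (hM : 0 < M) {W : Fin m → Fin n → ℝ}
    (hW : ∀ i j, 0 ≤ W i j) {R : Fin m → ℕ} {c : Fin n → ℕ} {r : Fin M → Fin m → ℕ}
    {ck : Fin M → Fin n → ℕ} (hR : ∑ i, R i = N) (hc : ∑ j, c j = N)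
    (hr : ∀ i, ∑ k, r k i = M * R i) (hck : ∀ j, ∑ k, ck k j = M * c j) :
    capConst N c ^ M * ∏ k, tableWeight (r k) (ck k) W ≤ tableWeight R c W ^ M := by
  have h := prod_coeff_rowsPoly_le hM (c := Finsupp.equivFunOnFinite.symm c)
    (ck := fun k => Finsupp.equivFunOnFinite.symm (ck k)) hc
    (by ext j; simpa [Finsupp.finsetSum_apply] using hck j) hW hR hr
  simp only [coeff_rowsPoly_eq_tableWeight] at h
  exact h

lemma tableWeight_nonneg {m : ℕ} {W : Fin m → Fin n → ℝ} (hW : ∀ i j, 0 ≤ W i j)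
    (R : Fin m → ℕ) (c : Fin n → ℕ) : 0 ≤ tableWeight R c W :=
  tsum_nonneg fun _ => prod_nonneg fun i _ => prod_nonneg fun j _ => pow_nonneg (hW i j) _

lemma prod_tableWeight_pow_le {m p N : ℕ} {W : Fin m → Fin n → ℝ} (hW : ∀ i j, 0 ≤ W i j)
    {R : Fin m → ℕ} {c : Fin n → ℕ} {r : Fin p → Fin m → ℕ} {ck : Fin p → Fin n → ℕ}
    (hR : ∑ i, R i = N) (hc : ∑ j, c j = N) (e : Fin p → ℕ) (he : 0 < ∑ k, e k)
    (hr : ∀ i, ∑ k, e k * r k i = (∑ k, e k) * R i)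
    (hck : ∀ j, ∑ k, e k * ck k j = (∑ k, e k) * c j) :
    capConst N c ^ (∑ k, e k) * ∏ k, tableWeight (r k) (ck k) W ^ e k ≤
      tableWeight R c W ^ (∑ k, e k) := by
  have hsum : ∀ a : Fin p → ℕ, ∑ x : Fin (∑ k, e k), a (finSigmaFinEquiv.symm x).1 =
      ∑ k, e k * a k := fun a => by
    rw [Equiv.sum_comp finSigmaFinEquiv.symm fun y : (k : Fin p) × Fin (e k) => a y.1,
      Fintype.sum_sigma]
    simp
  have hprod : ∀ a : Fin p → ℝ, ∏ x : Fin (∑ k, e k), a (finSigmaFinEquiv.symm x).1 =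
      ∏ k, a k ^ e k := fun a => by
    rw [Equiv.prod_comp finSigmaFinEquiv.symm fun y : (k : Fin p) × Fin (e k) => a y.1,
      Fintype.prod_sigma]
    simp
  have h := prod_tableWeight_le_pow he hW
    (r := fun x : Fin (∑ k, e k) => r (finSigmaFinEquiv.symm x).1)
    (ck := fun x : Fin (∑ k, e k) => ck (finSigmaFinEquiv.symm x).1) hR hc
    (fun i => (hsum fun k => r k i).trans (hr i)) (fun j => (hsum fun k => ck k j).trans (hck j))
  rwa [hprod fun k => tableWeight (r k) (ck k) W] at h

lemma exists_common_denominator {p : ℕ} (β : Fin p → ℚ) (hβ : ∀ k, 0 ≤ β k) :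
    ∃ M : ℕ, 0 < M ∧ ∃ e : Fin p → ℕ, ∀ k, β k * M = e k := by
  refine ⟨∏ k, (β k).den, prod_pos fun k _ => (β k).den_pos,
    fun k => (β k).num.toNat * ∏ i ∈ univ.erase k, (β i).den, fun k => ?_⟩
  have h1 : (((β k).num.toNat : ℤ) : ℚ) = (β k).num := by
    rw [Int.toNat_of_nonneg (Rat.num_nonneg.2 (hβ k))]
  rw [← mul_prod_erase univ _ (mem_univ k)]
  push_cast at h1 ⊢
  rw [h1, ← mul_assoc, Rat.mul_den_eq_num]

lemma prod_tableWeight_rpow_rat_le {m p N : ℕ} {W : Fin m → Fin n → ℝ} (hW : ∀ i j, 0 ≤ W i j)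
    {R : Fin m → ℕ} {c : Fin n → ℕ} {r : Fin p → Fin m → ℕ} {ck : Fin p → Fin n → ℕ}
    (hR : ∑ i, R i = N) (hc : ∑ j, c j = N) (β : Fin p → ℚ) (hβ : ∀ k, 0 ≤ β k)
    (hβ1 : ∑ k, β k = 1) (hr : ∀ i, ∑ k, β k * r k i = R i)
    (hck : ∀ j, ∑ k, β k * ck k j = c j) :
    capConst N c * ∏ k, tableWeight (r k) (ck k) W ^ (β k : ℝ) ≤ tableWeight R c W := by
  obtain ⟨M, hM, e, he⟩ := exists_common_denominator β hβ
  have hsum : ∀ (a : Fin p → ℕ) (b : ℕ), ∑ k, β k * a k = b → ∑ k, e k * a k = M * b := by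
    intro a b hab
    have : ((∑ k, e k * a k : ℕ) : ℚ) = (M * b : ℕ) := by
      push_cast
      rw [← hab, mul_sum]
      exact sum_congr rfl fun k _ => by rw [← he k]; ring
    exact_mod_cast this
  have heM : ∑ k, e k = M := by
    simpa using hsum (fun _ => 1) 1 (by simpa using hβ1)
  have h := prod_tableWeight_pow_le hW hR hc e (heM ▸ hM)
    (fun i => by rw [heM]; exact hsum _ _ (hr i)) (fun j => by rw [heM]; exact hsum _ _ (hck j))
  rw [heM] at h
  refine le_of_pow_le_pow_left₀ hM.ne' (tableWeight_nonneg hW R c) ?_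
  rw [mul_pow, ← prod_pow]
  have hpow : ∀ k, (tableWeight (r k) (ck k) W ^ (β k : ℝ)) ^ M =
      tableWeight (r k) (ck k) W ^ e k := fun k => by
    rw [← Real.rpow_mul_natCast (tableWeight_nonneg hW _ _), ← Real.rpow_natCast]
    congr 1
    exact_mod_cast he k
  simpa only [hpow] using h

lemma exists_seq_linearMap_tendsto :
    ∃ φ : ℕ → ℝ →ₗ[ℚ] ℚ, (∀ t, φ t 1 = 1) ∧
      ∀ a : ℝ, Filter.Tendsto (fun t => (φ t a : ℝ)) Filter.atTop (nhds a) := by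
  have hli : LinearIndepOn ℚ id ({1} : Set ℝ) := LinearIndepOn.singleton one_ne_zero
  set b := Module.Basis.extend hli with hb
  have hbv : ∀ i, b i = i := Module.Basis.extend_apply_self hli
  set q : ℕ → ℝ → ℚ := fun t x => ⌊x * (t + 1 : ℕ)⌋ / (t + 1 : ℕ) with hq
  have hq1 : ∀ t, q t 1 = 1 := fun t => by
    simp only [hq, one_mul, Int.floor_natCast, Int.cast_natCast]
    exact div_self (by positivity)
  have hqt : ∀ x, Filter.Tendsto (fun t => (q t x : ℝ)) Filter.atTop (nhds x) := by
    intro x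
    have h0 : Filter.Tendsto (fun t : ℕ => x - 1 / ((t : ℝ) + 1)) Filter.atTop (nhds x) := by
      simpa using tendsto_const_nhds.sub (tendsto_one_div_add_atTop_nhds_zero_nat (𝕜 := ℝ))
    refine tendsto_of_tendsto_of_tendsto_of_le_of_le h0 tendsto_const_nhds (fun t => ?_)
      fun t => ?_
    · have ht : (0 : ℝ) < (t : ℝ) + 1 := by positivity
      have := Int.sub_one_lt_floor (x * (t + 1 : ℕ))
      simp only [hq]
      push_cast at this ⊢
      rw [le_div_iff₀ ht, sub_mul, one_div, inv_mul_cancel₀ ht.ne']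
      exact this.le
    · have ht : (0 : ℝ) < (t : ℝ) + 1 := by positivity
      have := Int.floor_le (x * (t + 1 : ℕ))
      simp only [hq]
      push_cast at this ⊢
      rwa [div_le_iff₀ ht]
  refine ⟨fun t => b.constr ℚ fun i => q t i, fun t => ?_, fun a => ?_⟩
  · have h1 : (1 : ℝ) ∈ hli.extend (Set.subset_univ _) := hli.subset_extend _ rfl
    have h2 : b ⟨1, h1⟩ = 1 := hbv _
    calc b.constr ℚ (fun i => q t i) 1 = b.constr ℚ (fun i => q t i) (b ⟨1, h1⟩) := by rw [h2]
      _ = 1 := by rw [b.constr_basis]; exact hq1 t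
  · have ha : a = ∑ i ∈ (b.repr a).support, ((b.repr a i : ℚ) : ℝ) * (i : ℝ) := by
      conv_lhs => rw [← b.linearCombination_repr a, Finsupp.linearCombination_apply, Finsupp.sum]
      exact sum_congr rfl fun i _ => by rw [hbv, Rat.smul_def]
    have hφ : ∀ t, ((b.constr ℚ (fun i => q t i) a : ℚ) : ℝ) =
        ∑ i ∈ (b.repr a).support, ((b.repr a i : ℚ) : ℝ) * (q t i : ℝ) := fun t => by
      rw [b.constr_apply, Finsupp.sum]
      push_cast
      exact sum_congr rfl fun i _ => by rw [smul_eq_mul]; push_cast; rfl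
    simp only [hφ]
    conv => arg 3; rw [ha]
    exact tendsto_finsetSum _ fun i _ => (hqt i).const_mul _

lemma prod_tableWeight_rpow_le {m p N : ℕ} {W : Fin m → Fin n → ℝ} (hW : ∀ i j, 0 ≤ W i j)
    {R : Fin m → ℕ} {c : Fin n → ℕ} {r : Fin p → Fin m → ℕ} {ck : Fin p → Fin n → ℕ}
    (hR : ∑ i, R i = N) (hc : ∑ j, c j = N) (α : Fin p → ℝ) (hα : ∀ k, 0 ≤ α k)
    (hα1 : ∑ k, α k = 1) (hr : ∀ i, (R i : ℝ) = ∑ k, α k * r k i)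
    (hck : ∀ j, (c j : ℝ) = ∑ k, α k * ck k j) :
    capConst N c * ∏ k, tableWeight (r k) (ck k) W ^ α k ≤ tableWeight R c W := by
  by_cases hT : ∃ k, α k ≠ 0 ∧ tableWeight (r k) (ck k) W = 0
  · obtain ⟨k, hk, h0⟩ := hT
    rw [prod_eq_zero (mem_univ k) (by rw [h0, Real.zero_rpow hk]), mul_zero]
    exact tableWeight_nonneg hW R c
  push Not at hT
  obtain ⟨φ, hφ1, hφ⟩ := exists_seq_linearMap_tendsto
  have hφn : ∀ t (a : ℕ), φ t a = a := fun t a => by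
    have : (a : ℝ) = (a : ℚ) • (1 : ℝ) := by rw [Rat.smul_def]; simp
    rw [this, map_smul, hφ1, smul_eq_mul, mul_one]
  have hφs : ∀ t (a : Fin p → ℕ) (b : ℕ), (b : ℝ) = ∑ k, α k * a k →
      ∑ k, φ t (α k) * a k = b := fun t a b h => by
    rw [← hφn t b, h, map_sum]
    refine sum_congr rfl fun k _ => ?_
    have : α k * (a k : ℝ) = (a k : ℚ) • α k := by rw [Rat.smul_def]; push_cast; ring
    rw [this, map_smul, smul_eq_mul, mul_comm]
  have hφ0 : ∀ t k, α k = 0 → φ t (α k) = 0 := fun t k h => by rw [h, map_zero]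
  have hev : ∀ᶠ t in Filter.atTop, ∀ k, 0 ≤ φ t (α k) := by
    rw [Filter.eventually_all]
    intro k
    rcases eq_or_lt_of_le (hα k) with h | h
    · exact Filter.Eventually.of_forall fun t => (hφ0 t k h.symm).ge
    · filter_upwards [(hφ (α k)).eventually_const_lt h] with t ht
      exact_mod_cast ht.le
  have hle : ∀ᶠ t in Filter.atTop,
      capConst N c * ∏ k, tableWeight (r k) (ck k) W ^ ((φ t (α k) : ℚ) : ℝ) ≤
        tableWeight R c W := by
    filter_upwards [hev] with t ht
    refine prod_tableWeight_rpow_rat_le hW hR hc (fun k => φ t (α k)) ht ?_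
      (fun i => hφs t _ _ (hr i)) fun j => hφs t _ _ (hck j)
    simpa using hφs t (fun _ => 1) 1 (by simpa using hα1.symm)
  refine le_of_tendsto (Filter.Tendsto.const_mul _ (tendsto_finsetProd _ fun k _ => ?_)) hle
  by_cases hk : α k = 0
  · simp [hk]
  · exact (Real.continuousAt_const_rpow (hT k hk)).tendsto.comp (hφ (α k))

lemma prod_rpow_le_mul_tableWeight {m p N : ℕ} {W : Fin m → Fin n → ℝ} (hW : ∀ i j, 0 ≤ W i j)
    {R : Fin m → ℕ} {c : Fin n → ℕ} {r : Fin p → Fin m → ℕ} {ck : Fin p → Fin n → ℕ}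
    (hR : ∑ i, R i = N) (hc : ∑ j, c j = N) (α : Fin p → ℝ) (hα : ∀ k, 0 ≤ α k)
    (hα1 : ∑ k, α k = 1) (hr : ∀ i, (R i : ℝ) = ∑ k, α k * r k i)
    (hck : ∀ j, (c j : ℝ) = ∑ k, α k * ck k j) :
    ∏ k, tableWeight (r k) (ck k) W ^ α k ≤ ((N : ℝ) ^ N / (N.factorial : ℝ)) *
      (∏ j, ((c j).factorial : ℝ) / (c j : ℝ) ^ c j) * tableWeight R c W := by
  have h := prod_tableWeight_rpow_le hW hR hc α hα hα1 hr hck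
  have hinv : ((N : ℝ) ^ N / (N.factorial : ℝ)) *
      (∏ j, ((c j).factorial : ℝ) / (c j : ℝ) ^ c j) = (capConst N c)⁻¹ := by
    rw [capConst, mul_inv, inv_div, ← prod_inv_distrib]
    simp only [inv_div]
  rwa [hinv, inv_mul_eq_div, le_div_iff₀' (capConst_pos N c)]

end CellInduction

end Helpers

theorem brunn_minkowski_contingency_cor1 {m n p N : ℕ}
    (W : Fin m → Fin n → ℝ) (hW : ∀ i j, 0 ≤ W i j)
    (Rk : Fin p → Fin m → ℕ) (Ck : Fin p → Fin n → ℕ)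
    (hRkpos : ∀ k i, 0 < Rk k i) (hCkpos : ∀ k j, 0 < Ck k j)
    (hRkN : ∀ k, ∑ i, Rk k i = N) (hCkN : ∀ k, ∑ j, Ck k j = N)
    (α : Fin p → ℝ) (hα : ∀ k, 0 ≤ α k) (hα1 : ∑ k, α k = 1)
    (R : Fin m → ℕ) (C : Fin n → ℕ)
    (hRpos : ∀ i, 0 < R i) (hCpos : ∀ j, 0 < C j)
    (hR : ∀ i, (R i : ℝ) = ∑ k, α k * Rk k i)
    (hC : ∀ j, (C j : ℝ) = ∑ k, α k * Ck k j) :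
    ((N : ℝ) ^ N / (Nat.factorial N : ℝ)) *
        min (∏ i, (Nat.factorial (R i) : ℝ) / (R i : ℝ) ^ (R i))
            (∏ j, (Nat.factorial (C j) : ℝ) / (C j : ℝ) ^ (C j)) *
        tableWeight R C W ≥
      ∏ k, tableWeight (Rk k) (Ck k) W ^ (α k) := by
  have hsum : ∀ {d : ℕ} (a : Fin d → ℕ) (b : Fin p → Fin d → ℕ), (∀ k, ∑ i, b k i = N) →
      (∀ i, (a i : ℝ) = ∑ k, α k * b k i) → ∑ i, a i = N := by
    intro d a b hb hab
    have : ((∑ i, a i : ℕ) : ℝ) = N := by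
      push_cast
      simp only [hab]
      rw [Finset.sum_comm]
      simp only [← Finset.mul_sum, ← Nat.cast_sum, hb, ← Finset.sum_mul, hα1, one_mul]
    exact_mod_cast this
  have hRN := hsum R Rk hRkN hR
  have hCN := hsum C Ck hCkN hC
  rcases min_choice (∏ i, (Nat.factorial (R i) : ℝ) / (R i : ℝ) ^ (R i))
    (∏ j, (Nat.factorial (C j) : ℝ) / (C j : ℝ) ^ (C j)) with h | h <;> rw [h]
  · have := prod_rpow_le_mul_tableWeight (fun j i => hW i j) hCN hRN α hα hα1 hC hR
    simpa only [tableWeight_transpose] using this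
  · exact prod_rpow_le_mul_tableWeight hW hRN hCN α hα hα1 hR hC
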